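/- arXiv:0811.3787 — 4 statements merged into one kernel-verified Lean document; each statement's English description precedes it below -/
import Mathlib

section
/- Let A be a commutative alternative (possibly non-unital, non-associative) ring in which 3·x = 0 and (x*x)*x = 0 for every x ∈ A. Writing (x,y,z) = (x*y)*z − x*(y*z) for the associator, for all a, x₁, x₂, x₃, x₄, b, c ∈ A the following identity holds: ((((a,x₁,x₂),x₃,b),x₄,c),b,c) + ((((a,x₁,x₃),x₂,b),x₄,c),b,c) − ((((a,x₁,x₄),x₂,b),x₃,c),b,c) + ((((a,x₁,b),x₂,x₃),x₄,c),b,c) + ((((a,x₁,c),x₂,x₃),x₄,b),b,c) + ((((a,x₁,b),x₂,c),x₃,x₄),b,c) = 0. -/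
/-- The associator `(x,y,z) = (x*y)*z − x*(y*z)` in a non-unital non-associative ring. -/
def assoc3 {A : Type*} [NonUnitalNonAssocRing A] (x y z : A) : A :=
  (x * y) * z - x * (y * z)

section CommAlternative

variable {A : Type*} [NonUnitalNonAssocCommRing A] [Module (ZMod 3) A]

/-- Multiplication by `x`, as a `ZMod 3`-linear operator. -/
def mulOp (x : A) : Module.End (ZMod 3) A :=
  (AddMonoidHom.mulLeft x).toZModLinearMap 3

/-- The operator `a ↦ (a, x, y)` of a commutative alternative ring, as a commutator of
multiplications. -/
def assocOp (x y : A) : Module.End (ZMod 3) A :=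
  mulOp x * mulOp y - mulOp y * mulOp x

lemma mulOp_apply (x a : A) : mulOp x a = x * a := rfl

lemma mulOp_add (x y : A) : mulOp (x + y) = mulOp x + mulOp y := by
  ext a
  simp [mulOp_apply, add_mul]

lemma mulOp_sub (x y : A) : mulOp (x - y) = mulOp x - mulOp y := by
  ext a
  simp [mulOp_apply, sub_mul]

lemma assocOp_apply (x y a : A) : assocOp x y a = x * (y * a) - y * (x * a) := rfl

lemma assocOp_self (x : A) : assocOp x x = 0 := sub_self _

lemma assocOp_skew (x y : A) : assocOp x y = -assocOp y x := (neg_sub _ _).symm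

lemma assocOp_add_left (x w y : A) : assocOp (x + w) y = assocOp x y + assocOp w y := by
  simp only [assocOp, mulOp_add, mul_add, add_mul]
  abel

lemma assocOp_add_right (x y z : A) : assocOp x (y + z) = assocOp x y + assocOp x z := by
  simp only [assocOp, mulOp_add, mul_add, add_mul]
  abel

lemma assocOp_neg_right (x y : A) : assocOp x (-y) = -assocOp x y := by
  rw [eq_neg_iff_add_eq_zero, ← assocOp_add_right, neg_add_cancel]
  simpa using assocOp_add_right x 0 0

lemma mulOp_mul_self (halt : ∀ x y : A, (x * x) * y = x * (x * y))
    (x : A) : mulOp (x * x) = mulOp x * mulOp x := by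
  ext a
  exact halt x a

lemma mulOp_mul (halt : ∀ x y : A, (x * x) * y = x * (x * y))
    (x y : A) : mulOp (x * y) = -(mulOp x * mulOp y + mulOp y * mulOp x) := by
  have h := mulOp_mul_self halt (x + y)
  simp only [mul_add, add_mul, mulOp_add, mulOp_mul_self halt, mul_comm y x] at h
  linear_combination (norm := (match_scalars <;> decide)) (-1 : ZMod 3) • h

lemma assoc3_eq_assocOp (halt : ∀ x y : A, (x * x) * y = x * (x * y))
    (a x y : A) : assoc3 a x y = assocOp x y a := by
  have h := LinearMap.congr_fun (mulOp_mul halt x y) a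
  simp only [mulOp_apply, LinearMap.neg_apply, LinearMap.add_apply, Module.End.mul_apply] at h
  rw [assoc3, assocOp_apply, mul_comm (a * x) y, mul_comm a (x * y), mul_comm a x]
  linear_combination (norm := (match_scalars <;> decide)) (-1 : ZMod 3) • h

lemma mulOp_assocOp (halt : ∀ x y : A, (x * x) * y = x * (x * y)) (x y a : A) :
    mulOp (assocOp x y a) = assocOp x y * mulOp a - mulOp a * assocOp x y := by
  rw [assocOp_apply]
  simp only [mulOp_sub, mulOp_mul halt, assocOp, mul_sub, sub_mul, mul_add, add_mul,
    mul_neg, neg_mul, mul_assoc]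
  abel

lemma assocOp_mul_sub_mul_assocOp (halt : ∀ x y : A, (x * x) * y = x * (x * y)) (x y b c : A) :
    assocOp x y * assocOp b c - assocOp b c * assocOp x y =
      assocOp (assocOp x y b) c + assocOp b (assocOp x y c) := by
  rw [assocOp.eq_1 (assocOp x y b), assocOp.eq_1 b (assocOp x y c), mulOp_assocOp halt,
    mulOp_assocOp halt, assocOp.eq_1 b c]
  simp only [mul_sub, sub_mul, mul_assoc]
  abel

lemma mulOp_mul_mulOp_mul_mulOp (halt : ∀ x y : A, (x * x) * y = x * (x * y)) (x y : A) :
    mulOp x * (mulOp y * mulOp x) =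
      -(mulOp x * (mulOp x * mulOp y) + mulOp y * (mulOp x * mulOp x)) := by
  have h := congrArg mulOp (halt x y)
  simp only [mulOp_mul halt, mul_add, add_mul, mul_neg, neg_mul, mul_assoc] at h
  linear_combination (norm := (match_scalars <;> decide)) (1 : ZMod 3) • h

lemma mul_mul_mul_self (halt : ∀ x y : A, (x * x) * y = x * (x * y))
    (x y : A) : (x * y) * (x * y) = (x * x) * (y * y) := by
  have h := LinearMap.congr_fun (mulOp_mul halt x y) (x * y)
  have hx : x * (y * (x * y)) = (x * x) * (y * y) := by
    rw [mul_comm x y, ← halt y x, mul_comm (y * y) x, ← halt x]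
  have hy : y * (x * (x * y)) = (x * x) * (y * y) := by
    rw [← halt x y, mul_comm (x * x) y, ← halt y, mul_comm]
  simp only [mulOp_apply, LinearMap.neg_apply, LinearMap.add_apply, Module.End.mul_apply, hx,
    hy] at h
  linear_combination (norm := (match_scalars <;> decide)) (1 : ZMod 3) • h

lemma assocOp_mul_self (halt : ∀ x y : A, (x * x) * y = x * (x * y))
    (x y : A) : assocOp x y * assocOp x y = 0 := by
  have hsq := congrArg mulOp (mul_mul_mul_self halt x y)
  have hxyx := mulOp_mul_mulOp_mul_mulOp halt x (y * y)
  have hyxy := mulOp_mul_mulOp_mul_mulOp halt y (x * x)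
  simp only [mulOp_mul_self halt, mulOp_mul halt (x * x), mulOp_mul halt x y, mul_add, add_mul,
    mul_neg, neg_mul, mul_assoc] at hsq hxyx hyxy
  simp only [assocOp, mul_sub, sub_mul, mul_assoc]
  linear_combination (norm := (match_scalars <;> decide)) (1 : ZMod 3) • hsq + hxyx + hyxy

lemma assocOp_mul_add_mul_right (halt : ∀ x y : A, (x * x) * y = x * (x * y)) (x y z : A) :
    assocOp x y * assocOp x z + assocOp x z * assocOp x y = 0 := by
  have h := assocOp_mul_self halt x (y + z)
  simp only [assocOp_add_right, mul_add, add_mul, assocOp_mul_self halt] at h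
  linear_combination (norm := (match_scalars <;> decide)) (1 : ZMod 3) • h

/-- Full linearization of `assocOp x y * assocOp x y = 0`. -/
lemma assocOp_mul_exchange (halt : ∀ x y : A, (x * x) * y = x * (x * y)) (x w y z : A) :
    assocOp x y * assocOp w z + assocOp w y * assocOp x z + assocOp x z * assocOp w y
      + assocOp w z * assocOp x y = 0 := by
  have h := assocOp_mul_add_mul_right halt (x + w) y z
  have hx := assocOp_mul_add_mul_right halt x y z
  have hw := assocOp_mul_add_mul_right halt w y z
  simp only [assocOp_add_left, mul_add, add_mul] at h
  linear_combination (norm := (match_scalars <;> decide)) (1 : ZMod 3) • h - hx - hw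

lemma assocOp_apply_swap (halt : ∀ x y : A, (x * x) * y = x * (x * y)) (x y c : A) :
    assocOp x y c = -assocOp c y x := by
  have h := LinearMap.congr_fun (mulOp_mul halt x c) y
  simp only [mulOp_apply, LinearMap.neg_apply, LinearMap.add_apply, Module.End.mul_apply] at h
  rw [assocOp_apply, assocOp_apply, mul_comm y (x * c), mul_comm c x, mul_comm y (x * c), h,
    mul_comm y c, mul_comm y x]
  linear_combination (norm := (match_scalars <;> decide)) (0 : ZMod 3) • h

lemma assocOp_assocOp_self (halt : ∀ x y : A, (x * x) * y = x * (x * y)) (x y c : A) :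
    assocOp x (assocOp c y x) = assocOp x y * assocOp x c := by
  have h := assocOp_mul_sub_mul_assocOp halt x y x c
  have hx : assocOp x y x = 0 := by
    rw [assocOp_apply, mul_comm y x, ← halt x y, mul_comm y, sub_self]
  have h0 : assocOp (0 : A) c = 0 := by simpa using assocOp_add_left 0 0 c
  rw [hx, h0, assocOp_apply_swap halt x y c, assocOp_neg_right] at h
  have hxy := assocOp_mul_add_mul_right halt x y c
  linear_combination (norm := (match_scalars <;> decide)) (1 : ZMod 3) • h + hxy

/-- An associator in one slot of `assocOp` expands into products of two operators. -/
lemma assocOp_assocOp_right (halt : ∀ x y : A, (x * x) * y = x * (x * y)) (b c x y : A) :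
    assocOp b (assocOp x y c) = assocOp b c * assocOp x y - assocOp x y * assocOp b c
      - assocOp c y * assocOp b x - assocOp b y * assocOp c x := by
  have h := assocOp_assocOp_self halt (b + c) y x
  simp only [map_add, assocOp_add_left, assocOp_add_right, mul_add, add_mul,
    assocOp_assocOp_self halt] at h
  have hder := assocOp_mul_sub_mul_assocOp halt x y b c
  rw [assocOp_skew (assocOp x y b)] at hder
  linear_combination (norm := (match_scalars <;> decide)) (-1 : ZMod 3) • h + hder

lemma assocOp_assocOp_left (halt : ∀ x y : A, (x * x) * y = x * (x * y)) (b c x y : A) :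
    assocOp (assocOp x y c) b = assocOp x y * assocOp b c - assocOp b c * assocOp x y
      + assocOp c y * assocOp b x + assocOp b y * assocOp c x := by
  rw [assocOp_skew, assocOp_assocOp_right halt]
  abel

/-- Symmetrizing a product of three operators over their first letters gives zero. -/
lemma assocOp_sum_perm (halt : ∀ x y : A, (x * x) * y = x * (x * y))
    (y₁ y₂ y₃ p₁ p₂ p₃ : A) :
    assocOp y₃ p₃ * assocOp y₂ p₂ * assocOp y₁ p₁
      + assocOp y₂ p₃ * assocOp y₃ p₂ * assocOp y₁ p₁
      + assocOp y₃ p₃ * assocOp y₁ p₂ * assocOp y₂ p₁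
      + assocOp y₁ p₃ * assocOp y₃ p₂ * assocOp y₂ p₁
      + assocOp y₂ p₃ * assocOp y₁ p₂ * assocOp y₃ p₁
      + assocOp y₁ p₃ * assocOp y₂ p₂ * assocOp y₃ p₁ = 0 := by
  linear_combination (norm := skip) (1 : ZMod 3) • (
    assocOp_mul_exchange halt (assocOp p₁ y₁ p₃) p₂ y₂ y₃
    + assocOp_mul_exchange halt (assocOp p₁ y₃ p₃) p₂ y₁ y₂
    + assocOp_mul_exchange halt (assocOp p₁ y₂ p₃) p₂ y₁ y₃
    - assocOp_mul_exchange halt (assocOp p₂ p₃ y₁) p₁ y₂ y₃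
    - assocOp_mul_exchange halt (assocOp y₃ p₁ p₂) p₃ y₁ y₂
    - assocOp_mul_exchange halt (assocOp y₁ p₁ p₂) p₃ y₂ y₃
    - assocOp_mul_exchange halt (assocOp p₂ p₃ y₃) p₁ y₁ y₂
    - assocOp_mul_exchange halt (assocOp p₂ p₃ y₂) p₁ y₁ y₃
    - assocOp_mul_exchange halt (assocOp y₂ p₁ p₂) p₃ y₁ y₃)
  simp only [assocOp_assocOp_left halt]
  simp only [assocOp_skew y₂ y₁, assocOp_skew y₃ y₁, assocOp_skew p₁ y₁, assocOp_skew p₂ y₁,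
    assocOp_skew p₃ y₁, assocOp_skew y₃ y₂, assocOp_skew p₁ y₂, assocOp_skew p₂ y₂,
    assocOp_skew p₃ y₂, assocOp_skew p₁ y₃, assocOp_skew p₂ y₃, assocOp_skew p₃ y₃,
    assocOp_skew p₂ p₁, assocOp_skew p₃ p₁, mul_add, add_mul, mul_sub, sub_mul, mul_neg, neg_mul,
    mul_assoc]
  match_scalars <;> decide

lemma assocOp_sum_cyclic (halt : ∀ x y : A, (x * x) * y = x * (x * y))
    (x w p q r s : A) :
    assocOp r w * assocOp q s * assocOp p x
      + assocOp p w * assocOp r s * assocOp q x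
      + assocOp q w * assocOp p s * assocOp r x
      + assocOp r x * assocOp q s * assocOp p w
      + assocOp p x * assocOp r s * assocOp q w
      + assocOp q x * assocOp p s * assocOp r w = 0 := by
  linear_combination (norm := skip) (1 : ZMod 3) • (
    assocOp_mul_exchange halt (assocOp q w r) p x s
    + assocOp_mul_exchange halt (assocOp s p w) r x q
    + assocOp p s * (assocOp_mul_exchange halt x w q r)
    + assocOp_mul_exchange halt (assocOp s p x) r w q
    + (assocOp_mul_exchange halt x q r s) * (assocOp w p)
    + assocOp_mul_exchange halt (assocOp s p r) q x w
    + assocOp_mul_exchange halt (assocOp x p q) r w s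
    + assocOp_mul_exchange halt (assocOp p x w) s q r
    + assocOp_mul_exchange halt (assocOp x p r) q w s
    - assocOp_mul_exchange halt (assocOp r x q) p w s
    - assocOp_mul_exchange halt (assocOp w x p) s q r
    - (assocOp_mul_exchange halt w r q s) * (assocOp x p)
    - assocOp q r * (assocOp_mul_exchange halt x w p s)
    - (assocOp_mul_exchange halt x s q r) * (assocOp w p)
    - assocOp_mul_exchange halt (assocOp w p s) x q r)
  simp only [assocOp_assocOp_left halt]
  simp only [assocOp_skew w x, assocOp_skew p x, assocOp_skew q x, assocOp_skew r x,
    assocOp_skew s x, assocOp_skew p w, assocOp_skew q w, assocOp_skew r w, assocOp_skew s w,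
    assocOp_skew q p, assocOp_skew r p, assocOp_skew s p, assocOp_skew r q, assocOp_skew s q,
    assocOp_skew s r, mul_add, add_mul, mul_sub, sub_mul, mul_neg, neg_mul, mul_assoc, mul_zero,
    zero_mul]
  match_scalars <;> decide

lemma assocOp_three_term (halt : ∀ x y : A, (x * x) * y = x * (x * y))
    (x₁ x₂ x₃ x₄ b c : A) :
    assocOp b c * assocOp x₃ x₄ * assocOp b c * assocOp x₁ x₂
      - assocOp b c * assocOp x₂ x₄ * assocOp x₃ c * assocOp x₁ b
      - assocOp b c * assocOp x₂ x₃ * assocOp x₄ b * assocOp x₁ c = 0 := by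
  linear_combination (norm := skip) (1 : ZMod 3) • (
    (assocOp_sum_cyclic halt b b c c x₃ x₄) * (assocOp x₂ x₁)
    + (assocOp_mul_exchange halt x₂ b b c) * (assocOp x₄ x₃ * assocOp x₁ c)
    + (assocOp_sum_cyclic halt b b c x₃ x₂ c) * (assocOp x₄ x₁)
    + (assocOp_sum_cyclic halt x₃ b x₂ b c c) * (assocOp x₁ x₄)
    + assocOp b x₃ * (assocOp_sum_perm halt x₂ x₄ c x₁ b c)
    + assocOp b c * assocOp x₂ b * (assocOp_mul_exchange halt x₁ x₄ x₃ c)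
    + assocOp b x₂ * (assocOp_sum_cyclic halt c c b x₁ x₃ x₄)
    + (assocOp_sum_cyclic halt b b c x₄ x₂ c) * (assocOp x₃ x₁)
    + assocOp b c * (assocOp_mul_exchange halt x₂ c x₃ x₄) * (assocOp b x₁)
    + assocOp c b * (assocOp_sum_perm halt x₃ b c x₁ x₄ x₂)
    + assocOp b x₂ * (assocOp_sum_perm halt x₄ b c x₁ c x₃)
    + assocOp_sum_perm halt b b (assocOp x₄ c x₃) x₁ x₂ c
    - (assocOp_mul_exchange halt x₂ b x₃ b) * (assocOp x₄ c * assocOp x₁ c)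
    - (assocOp_mul_exchange halt c c x₃ b) * (assocOp x₂ x₄ * assocOp b x₁)
    - assocOp x₂ b * (assocOp_sum_cyclic halt x₃ c c x₄ x₁ b)
    - (assocOp_sum_perm halt x₂ c c x₄ x₃ b) * (assocOp b x₁)
    - (assocOp_mul_exchange halt x₄ c x₃ c) * (assocOp x₂ b * assocOp b x₁)
    - (assocOp_mul_exchange halt b b c c) * (assocOp x₄ x₃ * assocOp x₁ x₂)
    - assocOp b x₂ * assocOp x₃ c * (assocOp_mul_exchange halt x₁ c x₄ b)
    - (assocOp_sum_cyclic halt b b x₃ x₂ c x₄) * (assocOp x₁ c)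
    - assocOp b c * (assocOp_sum_perm halt x₄ b c x₁ x₃ x₂)
    - (assocOp_sum_perm halt b b c x₃ x₂ c) * (assocOp x₁ x₄)
    - assocOp x₃ c * (assocOp_sum_perm halt x₄ b b x₁ x₂ c)
    - (assocOp_sum_perm halt x₃ b c x₄ x₂ b) * (assocOp x₁ c)
    - assocOp b c * (assocOp_sum_perm halt x₂ x₄ b x₁ x₃ c))
  simp only [assocOp_assocOp_left halt]
  simp only [assocOp_skew x₂ x₁, assocOp_skew x₃ x₁, assocOp_skew x₄ x₁, assocOp_skew b x₁,
    assocOp_skew c x₁, assocOp_skew x₃ x₂, assocOp_skew x₄ x₂, assocOp_skew b x₂,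
    assocOp_skew c x₂, assocOp_skew x₄ x₃, assocOp_skew b x₃, assocOp_skew c x₃,
    assocOp_skew b x₄, assocOp_skew c x₄, assocOp_skew c b, assocOp_self, mul_add, add_mul,
    mul_sub, sub_mul, mul_neg, neg_mul, mul_assoc, mul_zero, zero_mul]
  match_scalars <;> decide

lemma assocOp_six_term (halt : ∀ x y : A, (x * x) * y = x * (x * y))
    (x₁ x₂ x₃ x₄ b c : A) :
    assocOp b c * assocOp x₄ c * assocOp x₃ b * assocOp x₁ x₂
      + assocOp b c * assocOp x₄ c * assocOp x₂ b * assocOp x₁ x₃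
      - assocOp b c * assocOp x₃ c * assocOp x₂ b * assocOp x₁ x₄
      + assocOp b c * assocOp x₄ c * assocOp x₂ x₃ * assocOp x₁ b
      + assocOp b c * assocOp x₄ b * assocOp x₂ x₃ * assocOp x₁ c
      + assocOp b c * assocOp x₃ x₄ * assocOp x₂ c * assocOp x₁ b = 0 := by
  linear_combination (norm := skip) (1 : ZMod 3) • (
    (assocOp_sum_cyclic halt b b c x₃ x₂ c) * (assocOp x₄ x₁)
    + (assocOp_mul_exchange halt b c b c) * (assocOp x₂ x₄ * assocOp x₃ x₁)
    + (assocOp_mul_exchange halt b b c c) * (assocOp x₄ x₃ * assocOp x₁ x₂)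
    + assocOp c b * (assocOp_mul_exchange halt x₄ c x₂ x₃) * (assocOp x₁ b)
    + assocOp b c * (assocOp_sum_perm halt x₂ x₄ b x₁ x₃ c)
    - (assocOp_sum_cyclic halt b b x₂ c c x₃) * (assocOp x₁ x₄)
    - (assocOp_sum_perm halt b c c x₂ x₄ b) * (assocOp x₁ x₃)
    - assocOp b c * (assocOp_sum_perm halt x₃ b c x₁ x₂ x₄)
    - assocOp c b * (assocOp_sum_perm halt x₃ x₄ b x₁ x₂ c)
    - assocOp_three_term halt x₁ x₄ x₂ x₃ c b)
  simp only [assocOp_skew x₂ x₁, assocOp_skew x₃ x₁, assocOp_skew x₄ x₁, assocOp_skew b x₁,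
    assocOp_skew c x₁, assocOp_skew x₃ x₂, assocOp_skew x₄ x₂, assocOp_skew b x₂,
    assocOp_skew c x₂, assocOp_skew x₄ x₃, assocOp_skew b x₃, assocOp_skew c x₃,
    assocOp_skew b x₄, assocOp_skew c x₄, assocOp_skew c b, assocOp_self, mul_add, add_mul,
    mul_neg, neg_mul, mul_assoc, mul_zero, zero_mul]
  match_scalars <;> decide

end CommAlternative

/-- In a commutative alternative (possibly non-unital, non-associative)
ring `A` with `3·x = 0` and `(x*x)*x = 0` for all `x`, the six-term associator
identity (corresponding to identity (3) of the paper) holds. -/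
theorem stmt_1 (A : Type*) [NonUnitalNonAssocCommRing A]
    (halt : ∀ x y : A, (x * x) * y = x * (x * y))
    (h3 : ∀ x : A, x + x + x = 0)
    (hcube : ∀ x : A, (x * x) * x = 0)
    (a x₁ x₂ x₃ x₄ b c : A) :
    assoc3 (assoc3 (assoc3 (assoc3 a x₁ x₂) x₃ b) x₄ c) b c
      + assoc3 (assoc3 (assoc3 (assoc3 a x₁ x₃) x₂ b) x₄ c) b c
      - assoc3 (assoc3 (assoc3 (assoc3 a x₁ x₄) x₂ b) x₃ c) b c
      + assoc3 (assoc3 (assoc3 (assoc3 a x₁ b) x₂ x₃) x₄ c) b c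
      + assoc3 (assoc3 (assoc3 (assoc3 a x₁ c) x₂ x₃) x₄ b) b c
      + assoc3 (assoc3 (assoc3 (assoc3 a x₁ b) x₂ c) x₃ x₄) b c = 0 := by
  let : Module (ZMod 3) A :=
    AddCommGroup.zmodModule fun x ↦ by rw [succ_nsmul, two_nsmul, h3]
  simp only [assoc3_eq_assocOp halt]
  exact LinearMap.congr_fun (assocOp_six_term halt x₁ x₂ x₃ x₄ b c) a
end

section
/- With G, d, T, gᵢ as in the context, let 𝒞₄ be the smallest 𝔽₃-subspace of G that contains g₀, g₁, g₂, g₃ and is closed under the ternary operation T. Then 𝒞₄ has 𝔽₃-dimension 12. -/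
/-- The Grassmann (exterior) algebra over `𝔽₃` of the free module with basis
indexed by `ℕ × ℕ`. -/
abbrev Gr : Type := ExteriorAlgebra (ZMod 3) ((ℕ × ℕ) →₀ ZMod 3)

/-- The generator `i^{(j)}` of the Grassmann algebra, i.e. `ι(e_{i,j})`. -/
noncomputable abbrev gen (i j : ℕ) : Gr :=
  ExteriorAlgebra.ι (ZMod 3) (Finsupp.single (i, j) (1 : ZMod 3))

/-- `gᵢ = ι(e_{i,0})`. -/
noncomputable abbrev g (i : ℕ) : Gr := gen i 0

open Module

section ExteriorSubmodule

variable {R M : Type*} [CommRing R] [AddCommGroup M] [Module R M]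

/-- Submodules of degree-one elements of an exterior algebra commute under multiplication. -/
theorem commute_map_ι (E F : Submodule R M) :
    Commute (E.map (ExteriorAlgebra.ι R)) (F.map (ExteriorAlgebra.ι R)) := by
  have key (E F : Submodule R M) :
      E.map (ExteriorAlgebra.ι R) * F.map (ExteriorAlgebra.ι R) ≤
        F.map (ExteriorAlgebra.ι R) * E.map (ExteriorAlgebra.ι R) := by
    rw [Submodule.mul_le]
    rintro _ ⟨x, hx, rfl⟩ _ ⟨y, hy, rfl⟩
    rw [eq_neg_of_add_eq_zero_left (ExteriorAlgebra.ι_add_mul_swap x y)]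
    exact neg_mem (Submodule.mul_mem_mul ⟨y, hy, rfl⟩ ⟨x, hx, rfl⟩)
  exact le_antisymm (key E F) (key F E)

variable {K V : Type*} [Field K] [AddCommGroup V] [Module K V]

theorem map_ι_pow_eq_map_exteriorPower (E : Submodule K V) (n : ℕ) :
    E.map (ExteriorAlgebra.ι K) ^ n =
      (⋀[K]^n E).map (ExteriorAlgebra.map E.subtype).toLinearMap := by
  rw [ExteriorAlgebra.exteriorPower, Submodule.map_pow, ExteriorAlgebra.ι_range_map_map, Submodule.range_subtype]

instance finiteDimensional_map_ι_pow (E : Submodule K V) [FiniteDimensional K E] (n : ℕ) :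
    FiniteDimensional K ↥(E.map (ExteriorAlgebra.ι K) ^ n) := by
  rw [map_ι_pow_eq_map_exteriorPower]
  infer_instance

theorem finrank_map_ι_pow_le (E : Submodule K V) [FiniteDimensional K E] (n : ℕ) :
    finrank K ↥(E.map (ExteriorAlgebra.ι K) ^ n) ≤ (finrank K E).choose n := by
  rw [map_ι_pow_eq_map_exteriorPower, ← exteriorPower.finrank_eq (R := K) (M := E) n]
  exact Submodule.finrank_map_le _ _

instance finiteDimensional_mul {A : Type*} [Ring A] [Algebra K A]
    (P Q : Submodule K A) [FiniteDimensional K P] [FiniteDimensional K Q] :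
    FiniteDimensional K ↥(P * Q) := by
  rw [← Submodule.mulMap_range]
  infer_instance

theorem finrank_mul_le_finrank_mul_finrank {A : Type*} [Ring A] [Algebra K A]
    (P Q : Submodule K A) [FiniteDimensional K P] [FiniteDimensional K Q] :
    finrank K ↥(P * Q) ≤ finrank K P * finrank K Q := by
  rw [← Submodule.mulMap_range, ← finrank_tensorProduct]
  exact LinearMap.finrank_range_le _

theorem map_mul_le_of_leibniz {A : Type*} [Ring A] [Algebra K A] {d : A →ₗ[K] A}
    (hLeib : ∀ u v : A, d (u * v) = d u * v + u * d v) (P Q : Submodule K A) :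
    (P * Q).map d ≤ P.map d * Q + P * Q.map d := by
  rw [Submodule.map_le_iff_le_comap, Submodule.mul_le]
  intro x hx y hy
  rw [Submodule.mem_comap, hLeib]
  exact Submodule.add_mem_sup (Submodule.mul_mem_mul (Submodule.mem_map_of_mem hx) hy)
    (Submodule.mul_mem_mul hx (Submodule.mem_map_of_mem hy))

/-- If `W` commutes with `Y` and `S` and `W ^ 5 = 0`, then the cube of `W + W²Y + W³S` has only the
two lowest order terms. -/
theorem cube_eq_of_pow_five_eq_zero {A : Type*} [IdemSemiring A] {W Y S : A}
    (hY : Commute W Y) (hS : Commute W S) (h5 : W ^ 5 = 0) :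
    (W + W ^ 2 * Y + W ^ 3 * S) * (W + W ^ 2 * Y + W ^ 3 * S) * (W + W ^ 2 * Y + W ^ 3 * S) =
      W ^ 3 + W ^ 4 * Y := by
  set T := Y + W * S with hT
  set Q := 1 + W * T with hQ
  have hWT : Commute W T := hY.add_right ((Commute.refl W).mul_right hS)
  have hWQ : Commute W Q := (Commute.one_right W).add_right ((Commute.refl W).mul_right hWT)
  have hP : W + W ^ 2 * Y + W ^ 3 * S = W * Q := by
    simp only [hQ, hT, mul_add, mul_one, ← mul_assoc, pow_succ, pow_zero, one_mul, add_assoc]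
  have hcube : W * Q * (W * Q) * (W * Q) = W ^ 3 * Q * Q * Q := by
    have e1 : W * Q * (W * Q) = W ^ 2 * (Q * Q) := by
      rw [← sq, hWQ.mul_pow, sq Q]
    rw [e1, mul_assoc, ← mul_assoc (Q * Q) W Q, ← (hWQ.mul_right hWQ).eq]
    simp only [pow_succ, pow_zero, one_mul, mul_assoc]
  have hlow : W ^ 3 * Q = W ^ 3 + W ^ 4 * Y := by
    have : W ^ 3 * Q = W ^ 3 + W ^ 4 * Y + W ^ 5 * S := by
      simp only [hQ, hT, mul_add, mul_one, ← mul_assoc, pow_succ, pow_zero, one_mul, add_assoc]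
    rw [this, h5, zero_mul, add_zero]
  have hhigh : W ^ 4 * Y * Q = W ^ 4 * Y := by
    have : W ^ 4 * Y * (W * T) = W ^ 5 * (Y * T) := by
      rw [mul_assoc, ← mul_assoc Y, ← hY.eq, pow_succ W 4]
      simp only [mul_assoc]
    rw [hQ, mul_add, mul_one, this, h5, zero_mul, add_zero]
  rw [hP, hcube, hlow, add_mul, hlow, hhigh, add_assoc, add_idem, add_mul, hlow, hhigh, add_assoc,
    add_idem]

end ExteriorSubmodule

section Monomials

/-- The product of the generators with indices in a list. -/
noncomputable def monomialOf (l : List (ℕ × ℕ)) : Gr := (l.map fun a => gen a.1 a.2).prod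

/-- The coefficient of the monomial `monomialOf l`. -/
noncomputable def monomialCoeff (l : List (ℕ × ℕ)) : Gr →ₗ[ZMod 3] ZMod 3 :=
  ExteriorAlgebra.liftAlternating fun n =>
    if l.length = n then
      Matrix.detRowAlternating.compLinearMap
        (LinearMap.pi fun k : Fin n => Finsupp.lapply (l.getD k (0, 0)))
    else 0

theorem monomialOf_eq_ιMulti (l : List (ℕ × ℕ)) :
    monomialOf l = ExteriorAlgebra.ιMulti (ZMod 3) l.length
      fun i => Finsupp.single (l.get i) (1 : ZMod 3) := by
  rw [ExteriorAlgebra.ιMulti_apply, monomialOf]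
  congr 1
  exact List.ext_get (by simp) (by simp [gen])

theorem monomialCoeff_self {l : List (ℕ × ℕ)} (hl : l.Nodup) :
    monomialCoeff l (monomialOf l) = 1 := by
  rw [monomialOf_eq_ιMulti, monomialCoeff, ExteriorAlgebra.liftAlternating_apply_ιMulti, if_pos rfl]
  rw [AlternatingMap.compLinearMap_apply]
  change Matrix.det _ = 1
  rw [← Matrix.det_one (n := Fin l.length) (R := ZMod 3)]
  congr 1
  ext i j
  simp [Matrix.one_apply, Finsupp.single_apply, hl.getElem_inj_iff, Fin.ext_iff]

theorem monomialCoeff_of_ne {l m : List (ℕ × ℕ)} (h : l.length ≠ m.length ∨ ∃ a ∈ m, a ∉ l) :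
    monomialCoeff l (monomialOf m) = 0 := by
  rw [monomialOf_eq_ιMulti, monomialCoeff, ExteriorAlgebra.liftAlternating_apply_ιMulti]
  split_ifs with hlen
  · obtain ⟨a, ham, hal⟩ := h.resolve_left (not_not.mpr hlen)
    obtain ⟨i, rfl⟩ := List.get_of_mem ham
    rw [AlternatingMap.compLinearMap_apply]
    refine Matrix.det_eq_zero_of_row_eq_zero i fun j => ?_
    have hj : (j : ℕ) < l.length := by rw [hlen]; exact j.2
    have : m[(i : ℕ)] ≠ l[(j : ℕ)] := fun e => hal (by simp [e])
    simp [hj, this]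
  · rfl

/-- The monomials appearing in the derivative of a monomial. -/
def derivTerms : List (ℕ × ℕ) → List (List (ℕ × ℕ))
  | [] => []
  | a :: l => ((a.1, a.2 + 1) :: l) :: (derivTerms l).map (a :: ·)

theorem map_monomialOf {d : Gr →ₗ[ZMod 3] Gr}
    (hLeib : ∀ u v : Gr, d (u * v) = d u * v + u * d v)
    (hd : ∀ i j : ℕ, d (gen i j) = gen i (j + 1)) (l : List (ℕ × ℕ)) :
    d (monomialOf l) = ((derivTerms l).map monomialOf).sum := by
  induction l with
  | nil =>
    have h := hLeib 1 1
    simp only [mul_one, one_mul] at h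
    simpa [monomialOf, derivTerms] using h
  | cons a l ih =>
    have hcons (b : ℕ × ℕ) (m : List (ℕ × ℕ)) :
        monomialOf (b :: m) = gen b.1 b.2 * monomialOf m := by simp [monomialOf]
    rw [hcons, hLeib, hd, ih]
    simp only [derivTerms, List.map_cons, List.sum_cons, hcons, List.map_map,
      ← List.sum_map_mul_left]
    rfl

end Monomials

section Basis

/-- The cubic and quintic monomials whose derivatives, together with the four generators, form a
basis of the closure. -/
def primitive (i : Fin 4) : Fin 2 → List (ℕ × ℕ)
  | 0 => [((i : ℕ), 0), (((i + 1 : Fin 4) : ℕ), 0), (((i + 2 : Fin 4) : ℕ), 0)]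
  | 1 => [((i : ℕ), 1), (((i + 3 : Fin 4) : ℕ), 0), ((i : ℕ), 0), (((i + 1 : Fin 4) : ℕ), 0),
      (((i + 2 : Fin 4) : ℕ), 0)]

/-- The monomials whose sum is the basis element with the given index. -/
def basisTerms : Fin 4 × Option (Fin 2) → List (List (ℕ × ℕ))
  | (i, none) => [[((i : ℕ), 0)]]
  | (i, some t) => derivTerms (primitive i t)

/-- The elements forming a basis of the closure of the four generators. -/
noncomputable def basisElement (s : Fin 4 × Option (Fin 2)) : Gr :=
  ((basisTerms s).map monomialOf).sum

theorem linearIndependent_basisElement : LinearIndependent (ZMod 3) basisElement := by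
  have hvanish (l : List (ℕ × ℕ)) (L : List (List (ℕ × ℕ)))
      (h : ∀ m ∈ L, l.length ≠ m.length ∨ ∃ a ∈ m, a ∉ l) :
      monomialCoeff l (L.map monomialOf).sum = 0 := by
    rw [map_list_sum]
    refine List.sum_eq_zero fun x hx => ?_
    simp only [List.map_map, List.mem_map, Function.comp_apply] at hx
    obtain ⟨m, hm, rfl⟩ := hx
    exact monomialCoeff_of_ne (h m hm)
  refine LinearIndependent.of_pairwise_dual_eq_zero_one _
    (fun s => monomialCoeff ((basisTerms s).headD [])) ?_ ?_
  · intro s t hst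
    refine hvanish _ _ ?_
    revert s t
    decide
  · intro s
    have hsplit : basisTerms s = (basisTerms s).headD [] :: (basisTerms s).tail := by
      revert s; decide
    have hnodup : ((basisTerms s).headD []).Nodup := by revert s; decide
    rw [basisElement]
    conv_lhs => rw [hsplit]
    rw [List.map_cons, List.sum_cons, map_add, List.headD_cons, monomialCoeff_self hnodup, hvanish,
      add_zero]
    revert s
    decide

end Basis

section Closure

variable {d : Gr →ₗ[ZMod 3] Gr}

theorem gen_mul_gen_comm (i j k l : ℕ) : gen i j * gen k l = -(gen k l * gen i j) :=
  eq_neg_of_add_eq_zero_left (ExteriorAlgebra.ι_add_mul_swap _ _)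

theorem gen_mul_self (i j : ℕ) : gen i j * gen i j = 0 := ExteriorAlgebra.ι_sq_zero _

theorem gen_mul_gen_mul_map (hLeib : ∀ u v : Gr, d (u * v) = d u * v + u * d v)
    (hd : ∀ i j : ℕ, d (gen i j) = gen i (j + 1)) (i j k l : ℕ) :
    gen l 0 * gen i 0 * d (gen i 0 * gen j 0 * gen k 0) =
      gen i 1 * (gen l 0 * (gen i 0 * (gen j 0 * gen k 0))) := by
  have hzero : gen l 0 * gen i 0 * gen i 0 = 0 := by rw [mul_assoc, gen_mul_self, mul_zero]
  have hswap : gen l 0 * gen i 0 * gen i 1 = gen i 1 * gen l 0 * gen i 0 := by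
    rw [mul_assoc, gen_mul_gen_comm i 0, mul_neg, ← mul_assoc, gen_mul_gen_comm l 0, neg_mul,
      neg_neg]
  simp only [hLeib, hd, mul_add, add_mul, zero_add, ← mul_assoc, hzero, hswap, zero_mul, add_zero]

theorem basisElement_mem (hLeib : ∀ u v : Gr, d (u * v) = d u * v + u * d v)
    (hd : ∀ i j : ℕ, d (gen i j) = gen i (j + 1)) {q : Submodule (ZMod 3) Gr}
    (hg : ∀ i < 4, g i ∈ q)
    (hq : ∀ x y z : Gr, x ∈ q → y ∈ q → z ∈ q → -d (x * y * z) ∈ q)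
    (s : Fin 4 × Option (Fin 2)) : basisElement s ∈ q := by
  have hq' (x y z : Gr) (hx : x ∈ q) (hy : y ∈ q) (hz : z ∈ q) : d (x * y * z) ∈ q :=
    neg_mem_iff.mp (hq x y z hx hy hz)
  have hg' (i : Fin 4) : g i ∈ q := hg i i.2
  have hcubic (i : Fin 4) :
      d (g i * g (i + 1 : Fin 4) * g (i + 2 : Fin 4)) ∈ q := hq' _ _ _ (hg' _) (hg' _) (hg' _)
  obtain ⟨i, _ | t⟩ := s
  · simpa [basisElement, basisTerms, monomialOf] using hg' i
  · rw [basisElement, basisTerms, ← map_monomialOf hLeib hd]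
    fin_cases t
    · simpa [primitive, monomialOf, mul_assoc] using hcubic i
    · have hquintic := hq' _ _ _ (hg' (i + 3)) (hg' i) (hcubic i)
      rw [gen_mul_gen_mul_map hLeib hd] at hquintic
      simpa [primitive, monomialOf] using hquintic

/-- The span of the vectors `e_{i,j}` with `i < 4`. -/
noncomputable def degreeOne (j : ℕ) : Submodule (ZMod 3) ((ℕ × ℕ) →₀ ZMod 3) :=
  Submodule.span (ZMod 3) (Set.range fun i : Fin 4 => Finsupp.single ((i : ℕ), j) 1)

instance (j : ℕ) : FiniteDimensional (ZMod 3) (degreeOne j) :=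
  FiniteDimensional.span_of_finite _ (Set.finite_range _)

theorem finrank_degreeOne_le (j : ℕ) : finrank (ZMod 3) (degreeOne j) ≤ 4 :=
  (finrank_range_le_card _).trans_eq (Fintype.card_fin 4)

/-- The span of the `j`-th derivatives of the four generators. -/
noncomputable abbrev genSpan (j : ℕ) : Submodule (ZMod 3) Gr :=
  (degreeOne j).map (ExteriorAlgebra.ι (ZMod 3))

theorem genSpan_eq_span (j : ℕ) :
    genSpan j = Submodule.span (ZMod 3) (Set.range fun i : Fin 4 => gen i j) := by
  rw [genSpan, degreeOne, Submodule.map_span, ← Set.range_comp]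
  rfl

theorem map_genSpan (hd : ∀ i j : ℕ, d (gen i j) = gen i (j + 1)) (j : ℕ) :
    (genSpan j).map d = genSpan (j + 1) := by
  rw [genSpan_eq_span, genSpan_eq_span, Submodule.map_span, ← Set.range_comp]
  congr 2
  funext i
  exact hd i j

/-- A subspace containing the four generators and closed under `-d (x * y * z)`. -/
noncomputable def closureBound (d : Gr →ₗ[ZMod 3] Gr) : Submodule (ZMod 3) Gr :=
  genSpan 0 + (genSpan 0 ^ 3).map d + (genSpan 0 ^ 4 * genSpan 1).map d

instance finiteDimensional_closureBound : FiniteDimensional (ZMod 3) (closureBound d) := by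
  unfold closureBound
  simp only [Submodule.add_eq_sup]
  infer_instance

theorem finrank_closureBound_le : finrank (ZMod 3) (closureBound d) ≤ 12 := by
  have hgen (j : ℕ) : finrank (ZMod 3) (genSpan j) ≤ 4 :=
    (Submodule.finrank_map_le _ _).trans (finrank_degreeOne_le j)
  have hpow (n : ℕ) : finrank (ZMod 3) ↥(genSpan 0 ^ n) ≤ Nat.choose 4 n :=
    (finrank_map_ι_pow_le _ n).trans (Nat.choose_le_choose n (finrank_degreeOne_le 0))
  have h3 : finrank (ZMod 3) ((genSpan 0 ^ 3).map d) ≤ 4 :=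
    (Submodule.finrank_map_le _ _).trans (hpow 3)
  have h4 : finrank (ZMod 3) ((genSpan 0 ^ 4 * genSpan 1).map d) ≤ 1 * 4 :=
    (Submodule.finrank_map_le _ _).trans
      ((finrank_mul_le_finrank_mul_finrank _ _).trans (Nat.mul_le_mul (hpow 4) (hgen 1)))
  have h12 := Submodule.finrank_add_le_finrank_add_finrank (genSpan 0) ((genSpan 0 ^ 3).map d)
  have h123 := Submodule.finrank_add_le_finrank_add_finrank
    (genSpan 0 ⊔ (genSpan 0 ^ 3).map d) ((genSpan 0 ^ 4 * genSpan 1).map d)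
  have := hgen 0
  unfold closureBound
  simp only [Submodule.add_eq_sup]
  omega

theorem genSpan_zero_pow_five : genSpan 0 ^ 5 = 0 := by
  rw [Submodule.zero_eq_bot, ← Submodule.finrank_eq_zero (R := ZMod 3), ← Nat.le_zero]
  exact (finrank_map_ι_pow_le _ 5).trans (Nat.choose_le_choose 5 (finrank_degreeOne_le 0))

theorem map_genSpan_pow_le (hLeib : ∀ u v : Gr, d (u * v) = d u * v + u * d v)
    (hd : ∀ i j : ℕ, d (gen i j) = gen i (j + 1)) (n : ℕ) :
    (genSpan 0 ^ (n + 1)).map d ≤ genSpan 0 ^ n * genSpan 1 := by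
  induction n with
  | zero => simp [map_genSpan hd]
  | succ n ih =>
    rw [pow_succ]
    refine (map_mul_le_of_leibniz hLeib _ _).trans ?_
    rw [map_genSpan hd]
    refine sup_le ((mul_le_mul' ih le_rfl).trans_eq ?_) le_rfl
    rw [mul_assoc, ← (commute_map_ι (degreeOne 0) (degreeOne 1)).eq, ← mul_assoc, ← pow_succ]

theorem map_mul_mul_mem_closureBound (hLeib : ∀ u v : Gr, d (u * v) = d u * v + u * d v)
    (hd : ∀ i j : ℕ, d (gen i j) = gen i (j + 1)) {x y z : Gr} (hx : x ∈ closureBound d)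
    (hy : y ∈ closureBound d) (hz : z ∈ closureBound d) :
    -d (x * y * z) ∈ closureBound d := by
  have hY : Commute (genSpan 0) (genSpan 1) := commute_map_ι _ _
  have hS : Commute (genSpan 0) (genSpan 1 * genSpan 1 + genSpan 0 * genSpan 2) :=
    (hY.mul_right hY).add_right ((Commute.refl _).mul_right (commute_map_ι _ _))
  have hle : closureBound d ≤ genSpan 0 + genSpan 0 ^ 2 * genSpan 1 +
      genSpan 0 ^ 3 * (genSpan 1 * genSpan 1 + genSpan 0 * genSpan 2) := by
    refine sup_le_sup (sup_le_sup le_rfl (map_genSpan_pow_le hLeib hd 2)) ?_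
    refine (map_mul_le_of_leibniz hLeib _ _).trans ?_
    rw [map_genSpan hd, mul_add, ← mul_assoc, ← mul_assoc, ← pow_succ]
    exact sup_le_sup (mul_le_mul' (map_genSpan_pow_le hLeib hd 3) le_rfl) le_rfl
  have hmem := Submodule.mul_mem_mul (Submodule.mul_mem_mul (hle hx) (hle hy)) (hle hz)
  rw [cube_eq_of_pow_five_eq_zero hY hS genSpan_zero_pow_five] at hmem
  have hmap := Submodule.mem_map_of_mem (f := d) hmem
  rw [Submodule.add_eq_sup, Submodule.map_sup] at hmap
  have hbound : (genSpan 0 ^ 3).map d ⊔ (genSpan 0 ^ 4 * genSpan 1).map d ≤ closureBound d :=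
    sup_le_sup le_sup_right le_rfl
  exact neg_mem (hbound hmap)

end Closure

/-- with `d` the derivation of `Gr` sending `ι(e_{i,j})` to
`ι(e_{i,j+1})` and `T x y z = -d (x*y*z)`, the smallest `𝔽₃`-subspace of `Gr`
containing `g₀, …, g_{3}` and closed under `T` has dimension `12`. -/
theorem stmt_2 (d : Gr →ₗ[ZMod 3] Gr)
    (hLeib : ∀ u v : Gr, d (u * v) = d u * v + u * d v)
    (hd : ∀ i j : ℕ, d (gen i j) = gen i (j + 1)) :
    Module.finrank (ZMod 3)
      ↥(sInf {p : Submodule (ZMod 3) Gr |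
          (∀ i < 4, g i ∈ p) ∧
          ∀ x y z : Gr, x ∈ p → y ∈ p → z ∈ p → -d (x * y * z) ∈ p}) = 12 := by
  have hupper : sInf {p : Submodule (ZMod 3) Gr | (∀ i < 4, g i ∈ p) ∧
      ∀ x y z : Gr, x ∈ p → y ∈ p → z ∈ p → -d (x * y * z) ∈ p} ≤ closureBound d := by
    refine sInf_le ⟨fun i hi => ?_, fun x y z => map_mul_mul_mem_closureBound hLeib hd⟩
    have hi' : g i ∈ genSpan 0 := by
      rw [genSpan_eq_span]
      exact Submodule.subset_span ⟨⟨i, hi⟩, rfl⟩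
    exact Submodule.mem_sup_left (Submodule.mem_sup_left hi')
  have hlower : Submodule.span (ZMod 3) (Set.range basisElement) ≤
      sInf {p : Submodule (ZMod 3) Gr | (∀ i < 4, g i ∈ p) ∧
        ∀ x y z : Gr, x ∈ p → y ∈ p → z ∈ p → -d (x * y * z) ∈ p} := by
    refine le_sInf fun q hq => Submodule.span_le.mpr ?_
    rintro _ ⟨s, rfl⟩
    exact basisElement_mem hLeib hd hq.1 hq.2 s
  have := Submodule.finiteDimensional_of_le hupper
  refine le_antisymm ((Submodule.finrank_mono hupper).trans finrank_closureBound_le) ?_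
  refine le_trans ?_ (Submodule.finrank_mono hlower)
  rw [finrank_span_eq_card linearIndependent_basisElement]
  decide
end

section
/- With G, d, T, gᵢ as in the context, let 𝒞₅ be the smallest 𝔽₃-subspace of G that contains g₀, g₁, g₂, g₃, g₄ and is closed under the ternary operation T. Then 𝒞₅ has 𝔽₃-dimension 49. -/
/-! ### Formal Grassmann polynomials

The generator `gen i j` with `i < 5` is encoded by the number `5 * j + i`, a monomial by the list of
its factors and a polynomial by a list of monomials with coefficients taken modulo `3`. -/

namespace Grassmann

/-- The generator encoded by `n`. -/
noncomputable def var (n : ℕ) : Gr := gen (n % 5) (n / 5)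

/-- The product of the generators in a list. -/
noncomputable def mon (l : List ℕ) : Gr := (l.map var).prod

/-- A formal linear combination of monomials. -/
abbrev Poly : Type := List (ℕ × List ℕ)

/-- The element of the Grassmann algebra represented by a formal polynomial. -/
noncomputable def eval (p : Poly) : Gr := (p.map fun t => (t.1 : ZMod 3) • mon t.2).sum

/-- Multiplication of a formal polynomial by a number. -/
def scale (c : ℕ) (p : Poly) : Poly := p.map fun t => (c * t.1, t.2)

/-- The product of formal polynomials. -/
def mul (p q : Poly) : Poly := p.flatMap fun s => q.map fun t => (s.1 * t.1, s.2 ++ t.2)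

/-- The monomials in the derivative of a monomial. -/
def bumps : List ℕ → List (List ℕ)
  | [] => []
  | a :: l => ((a + 5) :: l) :: (bumps l).map (a :: ·)

/-- The derivative of a formal polynomial. -/
def deriv (p : Poly) : Poly := p.flatMap fun t => (bumps t.2).map fun l => (t.1, l)

/-- Insertion of a factor into a sorted monomial, with the resulting coefficient. -/
def insertSign (a : ℕ) : List ℕ → ℕ × List ℕ
  | [] => (1, [a])
  | b :: l =>
    bif Nat.blt a b then (1, a :: b :: l)
    else bif Nat.beq a b then (0, [])
    else (2 * (insertSign a l).1 % 3, b :: (insertSign a l).2)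

/-- Sorting of a monomial, with the resulting coefficient. -/
def sortSign : List ℕ → ℕ × List ℕ
  | [] => (1, [])
  | a :: l =>
    ((sortSign l).1 * (insertSign a (sortSign l).2).1 % 3, (insertSign a (sortSign l).2).2)

/-- Addition of a term to a polynomial, collecting equal monomials. -/
def addTerm (c : ℕ) (m : List ℕ) : Poly → Poly
  | [] => [(c, m)]
  | t :: p =>
    bif m == t.2 then bif Nat.beq ((c + t.1) % 3) 0 then p else ((c + t.1) % 3, t.2) :: p
    else t :: addTerm c m p

/-- Sorting of all monomials of a polynomial and collection of equal ones. -/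
def normalize : Poly → Poly
  | [] => []
  | t :: p =>
    bif Nat.beq (t.1 * (sortSign t.2).1 % 3) 0 then normalize p
    else addTerm (t.1 * (sortSign t.2).1 % 3) (sortSign t.2).2 (normalize p)

lemma var_mul_self (a : ℕ) : var a * var a = 0 := ExteriorAlgebra.ι_sq_zero _

lemma var_mul_comm (a b : ℕ) : var a * var b = -(var b * var a) :=
  eq_neg_of_add_eq_zero_left (ExteriorAlgebra.ι_add_mul_swap _ _)

@[simp] lemma mon_nil : mon [] = 1 := rfl

@[simp] lemma mon_cons (a : ℕ) (l : List ℕ) : mon (a :: l) = var a * mon l := by simp [mon]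

@[simp] lemma mon_append (l m : List ℕ) : mon (l ++ m) = mon l * mon m := by simp [mon]

@[simp] lemma eval_nil : eval [] = 0 := rfl

@[simp] lemma eval_cons (t : ℕ × List ℕ) (p : Poly) :
    eval (t :: p) = (t.1 : ZMod 3) • mon t.2 + eval p := by simp [eval]

@[simp] lemma eval_append (p q : Poly) : eval (p ++ q) = eval p + eval q := by simp [eval]

lemma eval_scale (c : ℕ) (p : Poly) : eval (scale c p) = (c : ZMod 3) • eval p := by
  induction p with
  | nil => simp [scale]
  | cons t p ih =>
    rw [scale] at ih
    simp [scale, ih, mul_smul]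

lemma eval_mul (p q : Poly) : eval (mul p q) = eval p * eval q := by
  have monomial_mul (s : ℕ × List ℕ) : eval (q.map fun t => (s.1 * t.1, s.2 ++ t.2)) =
      ((s.1 : ZMod 3) • mon s.2) * eval q := by
    induction q with
    | nil => simp
    | cons t q ih => simp [ih, mul_add, smul_smul, mul_comm]
  induction p with
  | nil => simp [mul]
  | cons s p ih =>
    rw [mul] at ih
    simp [mul, ih, add_mul, monomial_mul]

section Derivation

variable {d : Gr →ₗ[ZMod 3] Gr}

lemma derivation_var (hd : ∀ i j : ℕ, d (gen i j) = gen i (j + 1)) (n : ℕ) :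
    d (var n) = var (n + 5) := by
  rw [var, hd, var, Nat.add_mod_right, Nat.add_div_right n (by norm_num)]

lemma derivation_mon (hLeib : ∀ u v : Gr, d (u * v) = d u * v + u * d v)
    (hd : ∀ i j : ℕ, d (gen i j) = gen i (j + 1)) (l : List ℕ) :
    d (mon l) = ((bumps l).map mon).sum := by
  induction l with
  | nil => simpa [bumps] using hLeib 1 1
  | cons a l ih =>
    have comp : mon ∘ (fun x => a :: x) = fun x => var a * mon x := by ext; simp
    simp [bumps, hLeib, derivation_var hd, ih, comp, List.sum_map_mul_left]

lemma eval_deriv (hLeib : ∀ u v : Gr, d (u * v) = d u * v + u * d v)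
    (hd : ∀ i j : ℕ, d (gen i j) = gen i (j + 1)) (p : Poly) : eval (deriv p) = d (eval p) := by
  have constant_coeff (c : ℕ) (L : List (List ℕ)) :
      eval (L.map fun l => (c, l)) = (c : ZMod 3) • (L.map mon).sum := by
    induction L with
    | nil => simp
    | cons l L ih => simp [ih]
  induction p with
  | nil => simp [deriv]
  | cons t p ih =>
    rw [deriv] at ih
    simp [deriv, ih, constant_coeff, derivation_mon hLeib hd]

end Derivation

lemma natCast_mod_three (n : ℕ) : ((n % 3 : ℕ) : ZMod 3) = n := ZMod.natCast_mod n 3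

lemma mon_insertSign (a : ℕ) (l : List ℕ) :
    var a * mon l = ((insertSign a l).1 : ZMod 3) • mon (insertSign a l).2 := by
  induction l with
  | nil => simp [insertSign]
  | cons b l ih =>
    rw [insertSign]
    cases h : Nat.blt a b
    · cases h' : Nat.beq a b
      · have two : (2 : ZMod 3) = -1 := rfl
        simp only [cond_false, natCast_mod_three, mon_cons]
        rw [← mul_assoc, var_mul_comm, neg_mul, mul_assoc, ih]
        simp [two]
      · obtain rfl := Nat.eq_of_beq_eq_true h'
        simp [← mul_assoc, var_mul_self]
    · simp

lemma mon_sortSign (l : List ℕ) :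
    mon l = ((sortSign l).1 : ZMod 3) • mon (sortSign l).2 := by
  induction l with
  | nil => simp [sortSign]
  | cons a l ih =>
    rw [mon_cons, ih, mul_smul_comm, mon_insertSign, sortSign, natCast_mod_three, Nat.cast_mul,
      mul_smul]

lemma eval_addTerm (c : ℕ) (m : List ℕ) (p : Poly) :
    eval (addTerm c m p) = (c : ZMod 3) • mon m + eval p := by
  induction p with
  | nil => simp [addTerm]
  | cons t p ih =>
    rw [addTerm]
    cases h : m == t.2
    · simp [ih, add_left_comm]
    · obtain rfl := eq_of_beq h
      have sum : (c : ZMod 3) • mon t.2 + eval (t :: p) =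
          (((c + t.1) % 3 : ℕ) : ZMod 3) • mon t.2 + eval p := by
        rw [natCast_mod_three, Nat.cast_add, add_smul, add_assoc, eval_cons]
      rw [sum]
      cases h' : Nat.beq ((c + t.1) % 3) 0
      · simp
      · simp [Nat.eq_of_beq_eq_true h']

lemma eval_normalize (p : Poly) : eval (normalize p) = eval p := by
  induction p with
  | nil => rfl
  | cons t p ih =>
    have term : (t.1 : ZMod 3) • mon t.2 =
        ((t.1 * (sortSign t.2).1 % 3 : ℕ) : ZMod 3) • mon (sortSign t.2).2 := by
      rw [mon_sortSign, natCast_mod_three, Nat.cast_mul, mul_smul]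
    rw [normalize, eval_cons, term]
    cases h : Nat.beq (t.1 * (sortSign t.2).1 % 3) 0
    · simp only [cond_false, eval_addTerm, ih]
    · simp [Nat.eq_of_beq_eq_true h, ih]

lemma eval_eq_zero_of_forall {p : Poly} (h : ∀ t ∈ p, (t.1 : ZMod 3) • mon t.2 = 0) :
    eval p = 0 := by
  refine List.sum_eq_zero fun x hx => ?_
  obtain ⟨t, ht, rfl⟩ := List.mem_map.1 hx
  exact h t ht

lemma mon_mul_comm_of_odd {l m : List ℕ} (hl : l.length % 2 = 1) (hm : m.length % 2 = 1) :
    mon l * mon m = -(mon m * mon l) := by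
  have var_mul (a : ℕ) (m : List ℕ) : var a * mon m = (-1) ^ m.length * (mon m * var a) := by
    induction m with
    | nil => simp
    | cons b m ih =>
      rw [mon_cons, ← mul_assoc, var_mul_comm, neg_mul, mul_assoc, ih, List.length_cons, pow_succ]
      rcases neg_one_pow_eq_or Gr m.length with h | h <;> simp [h, mul_assoc]
  have key (l : List ℕ) : mon l * mon m = (-1) ^ l.length * (mon m * mon l) := by
    induction l with
    | nil => simp
    | cons a l ih =>
      have h := var_mul a m
      rw [(Nat.odd_iff.2 hm).neg_one_pow, neg_one_mul] at h
      rw [mon_cons, mul_assoc, ih, List.length_cons, pow_succ]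
      rcases neg_one_pow_eq_or Gr l.length with h' | h' <;>
        simp [h', ← mul_assoc, h]
  rw [key, (Nat.odd_iff.2 hl).neg_one_pow, neg_one_mul]

lemma eval_mul_comm_of_odd {p q : Poly} (hp : ∀ t ∈ p, t.2.length % 2 = 1)
    (hq : ∀ t ∈ q, t.2.length % 2 = 1) : eval p * eval q = -(eval q * eval p) := by
  have monomial_mul (l : List ℕ) (hl : l.length % 2 = 1) :
      mon l * eval q = -(eval q * mon l) := by
    induction q with
    | nil => simp
    | cons t q ih =>
      rw [eval_cons, mul_add, add_mul, ih fun s hs => hq s (List.mem_cons_of_mem _ hs),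
        mul_smul_comm, smul_mul_assoc, mon_mul_comm_of_odd hl (hq t List.mem_cons_self)]
      simp [add_comm]
  induction p with
  | nil => simp
  | cons t p ih =>
    rw [eval_cons, mul_add, add_mul, ih fun s hs => hp s (List.mem_cons_of_mem _ hs),
      mul_smul_comm, smul_mul_assoc, monomial_mul _ (hp t List.mem_cons_self)]
    simp [add_comm]

/-! ### Vanishing of monomials of small weight -/

/-- The number of derivatives in a monomial. -/
def weight (l : List ℕ) : ℕ := (l.map (· / 5)).sum

lemma mon_eq_zero_of_not_nodup {l : List ℕ} (h : ¬ l.Nodup) : mon l = 0 := by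
  rw [List.nodup_iff_injective_get, Function.not_injective_iff] at h
  obtain ⟨i, j, hij, hne⟩ := h
  have key := (ExteriorAlgebra.ιMulti (ZMod 3) l.length).map_eq_zero_of_eq
    (fun k => Finsupp.single (l.get k % 5, l.get k / 5) (1 : ZMod 3)) (by simp only [hij]) hne
  rw [ExteriorAlgebra.ιMulti_apply] at key
  rw [mon, ← key]
  congr 1
  conv_lhs => rw [← List.ofFn_get l, List.map_ofFn]
  rfl

lemma mon_eq_zero_of_weight {l : List ℕ} (h : weight l + 6 ≤ l.length) : mon l = 0 := by
  refine mon_eq_zero_of_not_nodup fun hl => ?_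
  have small : (l.filter (· < 5)).length ≤ 5 := by
    have hsub : l.filter (· < 5) ⊆ List.range 5 := fun x hx => by
      simpa using (List.mem_filter.1 hx).2
    simpa using ((hl.filter _).subperm hsub).length_le
  have large (m : List ℕ) : m.length ≤ (m.filter (· < 5)).length + weight m := by
    induction m with
    | nil => simp
    | cons a m ih =>
      by_cases ha : a < 5
      · simp [weight, ha] at ih ⊢
        omega
      · simp [weight, ha] at ih ⊢
        omega
  have := large l
  omega

/-- The excess of the length over the weight, read off from the first monomial. -/
def level : Poly → ℕ
  | [] => 0
  | t :: _ => t.2.length - weight t.2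

/-- All monomials have the same excess of the length over the weight. -/
def isHomogeneous (p : Poly) : Bool := p.all fun t => Nat.beq t.2.length (weight t.2 + level p)

lemma eval_mul_eq_zero_of_level {p q r : Poly} (hp : isHomogeneous p = true)
    (hq : isHomogeneous q = true) (hr : isHomogeneous r = true)
    (h : 6 ≤ level p + level q + level r) : eval (mul p (mul q r)) = 0 := by
  refine eval_eq_zero_of_forall fun t ht => ?_
  simp only [mul, List.mem_flatMap, List.mem_map] at ht
  obtain ⟨a, ha, _, ⟨b, hb, c, hc, rfl⟩, rfl⟩ := ht
  have h₁ := Nat.eq_of_beq_eq_true (List.all_eq_true.1 hp a ha)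
  have h₂ := Nat.eq_of_beq_eq_true (List.all_eq_true.1 hq b hb)
  have h₃ := Nat.eq_of_beq_eq_true (List.all_eq_true.1 hr c hc)
  rw [mon_eq_zero_of_weight, smul_zero]
  simp only [weight, List.map_append, List.sum_append, List.length_append] at *
  omega

/-! ### Coefficient functionals -/

/-- Contraction of a monomial with a basis vector of the dual space. -/
def contractMon (a : ℕ) : List ℕ → Poly
  | [] => []
  | b :: l =>
    (bif Nat.beq a b then [(1, l)] else []) ++ (contractMon a l).map fun t => (2 * t.1, b :: t.2)

/-- Contraction of a formal polynomial with a basis vector of the dual space. -/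
def contract (a : ℕ) (p : Poly) : Poly := p.flatMap fun t => scale t.1 (contractMon a t.2)

/-- The coefficient of the empty monomial. -/
def constantCoeff (p : Poly) : ℕ := (p.map fun t => bif t.2.isEmpty then t.1 else 0).sum

/-- The coefficient of a given monomial, up to a sign. -/
def coeff : List ℕ → Poly → ℕ
  | [], p => constantCoeff p
  | a :: l, p => coeff l (contract a p)

/-- The functional underlying `coeff`. -/
noncomputable def coeffHom : List ℕ → Gr →ₗ[ZMod 3] ZMod 3
  | [] => (ExteriorAlgebra.algebraMapInv (R := ZMod 3) (M := (ℕ × ℕ) →₀ ZMod 3)).toLinearMap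
  | a :: l => coeffHom l ∘ₗ CliffordAlgebra.contractLeft (Finsupp.lapply (a % 5, a / 5))

lemma contractLeft_mon (a : ℕ) (l : List ℕ) :
    CliffordAlgebra.contractLeft (Q := (0 : QuadraticForm (ZMod 3) ((ℕ × ℕ) →₀ ZMod 3)))
      (Finsupp.lapply (a % 5, a / 5)) (mon l) = eval (contractMon a l) := by
  induction l with
  | nil => simp [contractMon]
  | cons b l ih =>
    have tail (p : Poly) : eval (p.map fun t => (2 * t.1, b :: t.2)) = -(var b * eval p) := by
      have two : (2 : ZMod 3) = -1 := rfl
      induction p with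
      | nil => simp
      | cons t p ih => simp [ih, two, mul_add, add_comm]
    rw [mon_cons, var, gen, ExteriorAlgebra.ι, CliffordAlgebra.contractLeft_ι_mul, ih, contractMon,
      eval_append, tail, sub_eq_add_neg]
    congr 1
    cases h : Nat.beq a b
    · have hne : ¬ (b % 5 = a % 5 ∧ b / 5 = a / 5) := by
        have := Nat.ne_of_beq_eq_false h
        omega
      simp [hne]
    · obtain rfl := Nat.eq_of_beq_eq_true h
      simp

lemma contractLeft_eval (a : ℕ) (p : Poly) :
    CliffordAlgebra.contractLeft (Q := (0 : QuadraticForm (ZMod 3) ((ℕ × ℕ) →₀ ZMod 3)))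
      (Finsupp.lapply (a % 5, a / 5)) (eval p) = eval (contract a p) := by
  induction p with
  | nil => simp [contract]
  | cons t p ih =>
    rw [contract] at ih
    simp [contract, ih, contractLeft_mon, eval_scale]

lemma coeffHom_eval (l : List ℕ) (p : Poly) : coeffHom l (eval p) = coeff l p := by
  induction l generalizing p with
  | nil =>
    induction p with
    | nil => simp [coeff, constantCoeff]
    | cons t p ih =>
      obtain ⟨c, m⟩ := t
      rw [coeff, constantCoeff] at ih ⊢
      rw [eval_cons, map_add, ih]
      cases m with
      | nil => simp [coeffHom]
      | cons a m =>
        have hι : ExteriorAlgebra.algebraMapInv (var a) = 0 := by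
          simp [var, ExteriorAlgebra.algebraMapInv]
        simp [coeffHom, hι]
  | cons a l ih =>
    rw [coeffHom, LinearMap.comp_apply, contractLeft_eval, ih, coeff]

/-! ### The basis -/

/-- The generator `g i`, or the derivative of a product of three generators. -/
def factor : List ℕ → Poly
  | [a] => [(1, [a % 5])]
  | [a, b, c] => deriv [(1, [a % 5, b % 5, c % 5])]
  | _ => []

/-- A normalized sum of products of three factors. -/
def productSum (w : List (List ℕ × List ℕ × List ℕ)) : Poly :=
  normalize (w.flatMap fun t => mul (factor t.1) (mul (factor t.2.1) (factor t.2.2)))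

/-- The triples of factors whose products, or sums of two products, have the derivatives that
form, together with the five generators, a basis. -/
def factorTriples : List (List (List ℕ × List ℕ × List ℕ)) :=
  ((List.sublistsLen 3 [0, 1, 2, 3, 4]).map fun
    | [a, b, c] => [([a], [b], [c])]
    | _ => []) ++
  ([0, 1, 2, 3, 4].flatMap fun a => (List.sublistsLen 3 ([0, 1, 2, 3, 4].erase a)).map fun
    | [b, c, e] => [([a], [b], [a, c, e])]
    | _ => []) ++
  ([0, 1, 2, 3].map fun i => match [0, 1, 2, 3].erase i with
    | [p, q, r] => [([r], [i], [4, p, q]), ([r], [4], [i, p, q])]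
    | _ => []) ++
  ((List.sublistsLen 2 [0, 1, 2, 3, 4]).map fun
    | [a, b] => match ([0, 1, 2, 3, 4].erase a).erase b with
      | [c, e, f] => [([a], [a, b, c], [b, e, f])]
      | _ => []
    | _ => [])

/-- Representatives of elements whose derivatives are, together with the five generators, a
basis. -/
def primitives : List Poly := factorTriples.map productSum

/-- Representatives of the basis. -/
def basisPolys : List Poly := [0, 1, 2, 3, 4].map (fun i => [(1, [i])]) ++ primitives.map deriv

/-- The first monomial of a polynomial. -/
def leading : Poly → List ℕ
  | [] => []
  | t :: _ => t.2

/-- The coefficient of the first monomial of a polynomial. -/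
def leadingCoeff : Poly → ℕ
  | [] => 0
  | t :: _ => t.1

/-- Monomials that single out the members of the basis. -/
def pivots : List (List ℕ) :=
  [0, 1, 2, 3, 4].map (fun i => [i]) ++
    primitives.map fun u => (leading u).dropLast ++ [(leading u).getLastD 0 + 5]

/-- The multiple of a member of `primitives` that cancels a given term. -/
def cancel (t : ℕ × List ℕ) : Poly :=
  match primitives.find? fun u => leading u == t.2 with
  | some u => scale (2 * t.1 * leadingCoeff u) u
  | none => []

/-- Reduction of a polynomial modulo the span of `primitives`. -/
def reduce (p : Poly) : Poly := normalize (p ++ p.flatMap cancel)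

lemma length_basisPolys : basisPolys.length = 49 := by decide +kernel

lemma isHomogeneous_of_mem_basisPolys : ∀ p ∈ basisPolys, isHomogeneous p = true := by
  decide +kernel

lemma coeff_pivots : ∀ i j : Fin 49,
    (coeff (pivots.getD i []) (basisPolys.getD j []) % 3 = 0 ↔ i ≠ j) := by
  decide +kernel

lemma one_le_level_of_mem_basisPolys : ∀ p ∈ basisPolys, 1 ≤ level p := by
  decide +kernel

lemma odd_of_mem_basisPolys : ∀ p ∈ basisPolys, ∀ t ∈ p, t.2.length % 2 = 1 := by
  decide +kernel

lemma reduce_mul : (basisPolys.all fun q => basisPolys.all fun r =>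
    !Nat.ble (level q) (level r) || Nat.ble 5 (level q + level r) || basisPolys.all fun p =>
      !Nat.ble (level p) (level q) || Nat.ble 6 (level p + level q + level r) ||
        (reduce (normalize (mul p (normalize (mul q r))))).isEmpty) = true := by
  decide +kernel

lemma eval_mem_of_reduce {Q : Submodule (ZMod 3) Gr} (hQ : ∀ u ∈ primitives, eval u ∈ Q) {p : Poly}
    (h : (reduce p).isEmpty = true) : eval p ∈ Q := by
  have cancel_mem (t : ℕ × List ℕ) : eval (cancel t) ∈ Q := by
    rw [cancel]
    split
    · next u hu =>
      rw [eval_scale]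
      exact Q.smul_mem _ (hQ u (List.mem_of_find?_eq_some hu))
    · simp
  have flatMap_mem (q : Poly) : eval (q.flatMap cancel) ∈ Q := by
    induction q with
    | nil => simp
    | cons t q ih => simpa using Q.add_mem (cancel_mem t) ih
  have hzero : eval p + eval (p.flatMap cancel) = 0 := by
    rw [← eval_append, ← eval_normalize, ← reduce, List.isEmpty_iff.1 h, eval_nil]
  rw [eq_neg_of_add_eq_zero_left hzero]
  exact Q.neg_mem (flatMap_mem p)

lemma eval_mul_mem {Q : Submodule (ZMod 3) Gr} (hQ : ∀ u ∈ primitives, eval u ∈ Q) {p q r : Poly}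
    (hp : p ∈ basisPolys) (hq : q ∈ basisPolys) (hr : r ∈ basisPolys) :
    eval p * (eval q * eval r) ∈ Q := by
  have sorted {p q r : Poly} (hp : p ∈ basisPolys) (hq : q ∈ basisPolys) (hr : r ∈ basisPolys)
      (hpq : level p ≤ level q) (hqr : level q ≤ level r) : eval p * (eval q * eval r) ∈ Q := by
    by_cases hlevel : 6 ≤ level p + level q + level r
    · rw [← eval_mul, ← eval_mul, eval_mul_eq_zero_of_level (isHomogeneous_of_mem_basisPolys p hp)
        (isHomogeneous_of_mem_basisPolys q hq) (isHomogeneous_of_mem_basisPolys r hr) hlevel]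
      exact Q.zero_mem
    · have hpos := one_le_level_of_mem_basisPolys p hp
      have hpair : ¬ 5 ≤ level q + level r := by omega
      have h := List.all_eq_true.1 (List.all_eq_true.1 reduce_mul q hq) r hr
      simp only [Nat.ble_eq, hqr, hpair, Bool.or_eq_true, Bool.not_eq_true', Bool.eq_false_iff,
        ne_eq, not_true_eq_false, false_or, List.all_eq_true] at h
      have h' := h p hp
      simp only [hpq, hlevel, not_true_eq_false, false_or] at h'
      rw [← eval_mul q r, ← eval_normalize (mul q r), ← eval_mul, ← eval_normalize]
      exact eval_mem_of_reduce hQ h'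
  have anticomm {p q : Poly} (hp : p ∈ basisPolys) (hq : q ∈ basisPolys) :
      eval p * eval q = -(eval q * eval p) :=
    eval_mul_comm_of_odd (odd_of_mem_basisPolys p hp) (odd_of_mem_basisPolys q hq)
  have swap_right {p q r : Poly} (hq : q ∈ basisPolys) (hr : r ∈ basisPolys)
      (h : eval p * (eval r * eval q) ∈ Q) : eval p * (eval q * eval r) ∈ Q := by
    rw [anticomm hq hr, mul_neg]
    exact Q.neg_mem h
  have swap_left {p q r : Poly} (hp : p ∈ basisPolys) (hq : q ∈ basisPolys)
      (h : eval q * (eval p * eval r) ∈ Q) : eval p * (eval q * eval r) ∈ Q := by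
    rw [← mul_assoc, anticomm hp hq, neg_mul, mul_assoc]
    exact Q.neg_mem h
  rcases le_total (level p) (level q) with hpq | hpq <;>
    rcases le_total (level q) (level r) with hqr | hqr <;>
    rcases le_total (level p) (level r) with hpr | hpr
  · exact sorted hp hq hr hpq hqr
  · exact sorted hp hq hr hpq hqr
  · exact swap_right hq hr (sorted hp hr hq hpr hqr)
  · exact swap_right hq hr (swap_left hp hr (sorted hr hp hq hpr hpq))
  · exact swap_left hp hq (sorted hq hp hr hpq hpr)
  · exact swap_left hp hq (swap_right hp hr (sorted hq hr hp hqr hpr))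
  · exact swap_left hp hq (swap_right hp hr (swap_left hq hr (sorted hr hq hp hqr hpq)))
  · exact swap_left hp hq (swap_right hp hr (swap_left hq hr (sorted hr hq hp hqr hpq)))

/-- The basis of the subspace generated by `g 0, …, g 4`. -/
noncomputable def basisVec (i : Fin 49) : Gr := eval (basisPolys.getD i [])

lemma linearIndependent_basisVec : LinearIndependent (ZMod 3) basisVec := by
  rw [Fintype.linearIndependent_iff]
  intro c hc i
  have hcoeff (j : Fin 49) : coeffHom (pivots.getD i []) (basisVec j) = 0 ↔ i ≠ j := by
    rw [basisVec, coeffHom_eval, ZMod.natCast_eq_zero_iff, Nat.dvd_iff_mod_eq_zero]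
    exact coeff_pivots i j
  have h := congrArg (coeffHom (pivots.getD i [])) hc
  rw [map_sum, map_zero, Finset.sum_eq_single i, map_smul, smul_eq_mul] at h
  · exact (mul_eq_zero.1 h).resolve_right fun h0 => (hcoeff i).1 h0 rfl
  · intro j _ hji
    rw [map_smul, (hcoeff j).2 hji.symm, smul_zero]
  · exact fun hi => absurd (Finset.mem_univ i) hi

lemma range_basisVec : Set.range basisVec = {x | ∃ p ∈ basisPolys, eval p = x} := by
  ext x
  constructor
  · rintro ⟨i, rfl⟩
    have hi : (i : ℕ) < basisPolys.length := i.2.trans_eq length_basisPolys.symm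
    exact ⟨_, List.getElem_mem hi, by rw [basisVec, List.getD_eq_getElem _ _ hi]⟩
  · rintro ⟨p, hp, rfl⟩
    obtain ⟨n, hn, rfl⟩ := List.getElem_of_mem hp
    exact ⟨⟨n, hn.trans_eq length_basisPolys⟩, by rw [basisVec, List.getD_eq_getElem _ _ hn]⟩

lemma eval_generator {i : ℕ} (hi : i < 5) : eval [(1, [i])] = g i := by
  simp [var, Nat.mod_eq_of_lt hi, Nat.div_eq_of_lt hi]

section Closure

variable {d : Gr →ₗ[ZMod 3] Gr} {S : Submodule (ZMod 3) Gr}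

lemma eval_factor_mem (hLeib : ∀ u v : Gr, d (u * v) = d u * v + u * d v)
    (hd : ∀ i j : ℕ, d (gen i j) = gen i (j + 1)) (hg : ∀ i < 5, g i ∈ S)
    (hS : ∀ x y z : Gr, x ∈ S → y ∈ S → z ∈ S → -d (x * y * z) ∈ S) (l : List ℕ) :
    eval (factor l) ∈ S := by
  have var_mem (a : ℕ) : var (a % 5) ∈ S := by
    have ha := Nat.mod_lt a (show 5 > 0 by norm_num)
    simpa [← eval_generator ha] using hg _ ha
  rw [factor.eq_def]
  split
  · next a => simpa using var_mem a
  · next a b c =>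
    rw [eval_deriv hLeib hd]
    simpa [mul_assoc] using hS _ _ _ (var_mem a) (var_mem b) (var_mem c)
  · simp

lemma derivation_primitive_mem (hLeib : ∀ u v : Gr, d (u * v) = d u * v + u * d v)
    (hd : ∀ i j : ℕ, d (gen i j) = gen i (j + 1)) (hg : ∀ i < 5, g i ∈ S)
    (hS : ∀ x y z : Gr, x ∈ S → y ∈ S → z ∈ S → -d (x * y * z) ∈ S) {u : Poly}
    (hu : u ∈ primitives) : d (eval u) ∈ S := by
  obtain ⟨w, -, rfl⟩ := List.mem_map.1 hu
  clear hu
  rw [productSum, eval_normalize]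
  induction w with
  | nil => simp
  | cons t w ih =>
    have hf := eval_factor_mem hLeib hd hg hS
    have h := hS _ _ _ (hf t.1) (hf t.2.1) (hf t.2.2)
    rw [S.neg_mem_iff, mul_assoc] at h
    rw [List.flatMap_cons, eval_append, map_add, eval_mul, eval_mul]
    exact S.add_mem h ih

lemma eval_basisPoly_mem (hLeib : ∀ u v : Gr, d (u * v) = d u * v + u * d v)
    (hd : ∀ i j : ℕ, d (gen i j) = gen i (j + 1)) (hg : ∀ i < 5, g i ∈ S)
    (hS : ∀ x y z : Gr, x ∈ S → y ∈ S → z ∈ S → -d (x * y * z) ∈ S) {p : Poly}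
    (hp : p ∈ basisPolys) : eval p ∈ S := by
  rcases List.mem_append.1 hp with hp | hp
  · obtain ⟨i, hi, rfl⟩ := List.mem_map.1 hp
    have hi' : i < 5 := by
      simp only [List.mem_cons, List.not_mem_nil, or_false] at hi
      omega
    rw [eval_generator hi']
    exact hg i hi'
  · obtain ⟨u, hu, rfl⟩ := List.mem_map.1 hp
    rw [eval_deriv hLeib hd]
    exact derivation_primitive_mem hLeib hd hg hS hu

end Closure

end Grassmann

/-- with `d` the derivation of `Gr` sending `ι(e_{i,j})` to
`ι(e_{i,j+1})` and `T x y z = -d (x*y*z)`, the smallest `𝔽₃`-subspace of `Gr`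
containing `g₀, …, g_{4}` and closed under `T` has dimension `49`. -/
theorem stmt_3 (d : Gr →ₗ[ZMod 3] Gr)
    (hLeib : ∀ u v : Gr, d (u * v) = d u * v + u * d v)
    (hd : ∀ i j : ℕ, d (gen i j) = gen i (j + 1)) :
    Module.finrank (ZMod 3)
      ↥(sInf {p : Submodule (ZMod 3) Gr |
          (∀ i < 5, g i ∈ p) ∧
          ∀ x y z : Gr, x ∈ p → y ∈ p → z ∈ p → -d (x * y * z) ∈ p}) = 49 := by
  have hspan : sInf {p : Submodule (ZMod 3) Gr | (∀ i < 5, g i ∈ p) ∧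
      ∀ x y z : Gr, x ∈ p → y ∈ p → z ∈ p → -d (x * y * z) ∈ p} =
      Submodule.span (ZMod 3) (Set.range Grassmann.basisVec) := by
    rw [Grassmann.range_basisVec]
    refine le_antisymm (sInf_le ⟨fun i hi => Submodule.subset_span ?_, ?_⟩) (le_sInf ?_)
    · refine ⟨[(1, [i])], List.mem_append_left _ (List.mem_map.2 ⟨i, ?_, rfl⟩),
        Grassmann.eval_generator hi⟩
      simp only [List.mem_cons, List.not_mem_nil, or_false]
      omega
    · set P := Submodule.span (ZMod 3) {x | ∃ p ∈ Grassmann.basisPolys, Grassmann.eval p = x}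
        with hP
      have hprim : ∀ u ∈ Grassmann.primitives, Grassmann.eval u ∈ P.comap d := fun u hu =>
        Submodule.subset_span ⟨_, List.mem_append_right _ (List.mem_map_of_mem hu),
          Grassmann.eval_deriv hLeib hd u⟩
      have hmul : P * (P * P) ≤ P.comap d := by
        rw [hP, Submodule.span_mul_span, Submodule.span_mul_span, Submodule.span_le]
        rintro _ ⟨_, ⟨p, hp, rfl⟩, _, ⟨_, ⟨q, hq, rfl⟩, _, ⟨r, hr, rfl⟩, rfl⟩, rfl⟩
        exact Grassmann.eval_mul_mem hprim hp hq hr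
      intro x y z hx hy hz
      rw [mul_assoc]
      exact P.neg_mem (hmul (Submodule.mul_mem_mul hx (Submodule.mul_mem_mul hy hz)))
    · rintro S ⟨hg, hS⟩
      rw [Submodule.span_le]
      rintro _ ⟨p, hp, rfl⟩
      exact Grassmann.eval_basisPoly_mem hLeib hd hg hS hp
  rw [hspan, finrank_span_eq_card Grassmann.linearIndependent_basisVec, Fintype.card_fin]
end

section
/- With G, d, T, gᵢ as in the context, let 𝒞₇ be the smallest 𝔽₃-subspace of G that contains g₀, g₁, g₂, g₃, g₄, g₅, g₆ and is closed under the ternary operation T. Then 𝒞₇ has 𝔽₃-dimension 1014. -/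
/-! ### Words and polynomials

The letter `n` stands for the generator `gen (n % 7) (n / 7)`, so that `d` acts on letters as
`n ↦ n + 7`. A word is a list of letters, and a polynomial is a list of words with coefficients
in `ℕ`, read modulo `3`. -/

namespace Word

/-- A list of terms, each a coefficient (read modulo `3`) and a word. -/
abbrev Poly : Type := List (ℕ × List ℕ)

/-- The bitmask of a word; on squarefree words it determines the set of letters. -/
def key (w : List ℕ) : ℕ := (w.map (2 ^ ·)).sum

/-- Left multiplication of each term of a polynomial by the letter `n`. -/
def consLetter (n : ℕ) (p : Poly) : Poly := p.map fun t => (t.1, n :: t.2)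

/-- Right multiplication of a polynomial by a word. -/
def appendWord (p : Poly) (v : List ℕ) : Poly := p.map fun t => (t.1, t.2 ++ v)

/-- The value on a word of the derivation with `φ n` as its value on the letter `n`. -/
def deriveWord (φ : ℕ → List (ℕ × ℕ)) : List ℕ → Poly
  | [] => []
  | n :: w => (φ n).map (fun t => (t.1, t.2 :: w)) ++ consLetter n (deriveWord φ w)

/-- The value on a polynomial of the derivation with `φ n` as its value on the letter `n`. -/
def derive (φ : ℕ → List (ℕ × ℕ)) (p : Poly) : Poly :=
  p.flatMap fun t => (deriveWord φ t.2).map fun u => (t.1 * u.1, u.2)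

/-- The derivation `d` on letters. -/
def raise (n : ℕ) : List (ℕ × ℕ) := [(1, n + 7)]

/-- The coefficient of the lowering derivation of step one. -/
def lowerCoeff (j : ℕ) : ℕ := if j % 3 = 1 then 1 else 0

/-- The coefficient of the lowering derivation of step two. -/
def lowerTwoCoeff (j : ℕ) : ℕ := (j + 1) / 3

/-- The sum of the two lowering derivations on letters. -/
def lower (n : ℕ) : List (ℕ × ℕ) :=
  [(lowerCoeff (n / 7), n - 7), (lowerTwoCoeff (n / 7), n - 14)]

/-- Insertion of a letter into an increasing word, with its sign. -/
def insertLetter (n : ℕ) : List ℕ → ℕ × List ℕ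
  | [] => (1, [n])
  | m :: w =>
    if n < m then (1, n :: m :: w)
    else if n = m then (0, [])
    else (2 * (insertLetter n w).1, m :: (insertLetter n w).2)

/-- The increasing rearrangement of a word, with its sign. -/
def sortWord : List ℕ → ℕ × List ℕ
  | [] => (1, [])
  | n :: w => ((sortWord w).1 * (insertLetter n (sortWord w).2).1,
      (insertLetter n (sortWord w).2).2)

/-- Addition of a term to a polynomial, collecting like terms. -/
def addTerm (t : ℕ × List ℕ) : Poly → Poly
  | [] => [t]
  | u :: p => if t.2 = u.2 then (t.1 + u.1, u.2) :: p else u :: addTerm t p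

/-- The normal form of a polynomial. -/
def normalize (p : Poly) : Poly :=
  (p.foldr (fun t q => addTerm (t.1 * (sortWord t.2).1, (sortWord t.2).2) q) []).filter
    fun t => t.1 % 3 ≠ 0

/-- The largest bitmask of a word of a polynomial, and whether it is attained by a single term,
with nonzero coefficient and no repeated letter. -/
def lead : Poly → ℕ × Bool
  | [] => (0, false)
  | t :: p =>
    bif Nat.blt (lead p).1 (key t.2) then (key t.2, decide (t.1 % 3 ≠ 0) && decide t.2.Nodup)
    else bif Nat.beq (lead p).1 (key t.2) then (key t.2, false)
    else lead p

/-- The effect of the derivation `d` on the bitmask of a leading word. -/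
def raiseKey (k : ℕ) : ℕ := k + 127 * 2 ^ Nat.log2 k

/-- A test whether the numbers in a list are distinct modulo `2 ^ b`. -/
def distinctMod : ℕ → List ℕ → Bool
  | _, [] => true
  | _, [_] => true
  | 0, _ => false
  | b + 1, l => distinctMod b (l.filter (Nat.testBit · b)) &&
      distinctMod b (l.filter fun k => !Nat.testBit k b)

/-- The product of the squares `e q * e (q + 7)` for `q` in a list. -/
def squares (v : List ℕ) : List ℕ := v.flatMap fun q => [q, q + 7]

/-- The polynomial `d p * e j * e k`. -/
def extend (p : Poly) (j k : ℕ) : Poly := appendWord (derive raise p) [j, k]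

/-- The element exchanging the derivative between the letters `a` and `b` in `a b c d e`. -/
def exchange (a b c d e : ℕ) : Poly :=
  extend [(1, [a, c, d])] b e ++ extend [(1, [b, c, d])] a e

/-- The sublists of a list, of any length. -/
def subsets : List ℕ → List (List ℕ)
  | [] => [[]]
  | n :: w => subsets w ++ (subsets w).map (n :: ·)

/-- The sublists of `[0, …, 6]` with `k` elements. -/
def choices (k : ℕ) : List (List ℕ) := (subsets (List.range 7)).filter (·.length = k)

/-- The elements of `[0, …, 6]` outside a list. -/
def others (w : List ℕ) : List ℕ := (List.range 7).filter (· ∉ w)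

/-- The products of a polynomial with squares of letters taken from a list. -/
def withSquares (p : Poly) (v : List ℕ) : List Poly :=
  (subsets v).map fun q => appendWord p (squares q)

/-- The elements with three letters of odd degree. -/
def cubics : List Poly :=
  (choices 3).flatMap fun w => withSquares [(1, w)] (others w)

/-- The exchange elements in five letters, times squares. -/
def quintics : List Poly :=
  (choices 5).flatMap fun
    | [a, b, c, d, e] =>
      [exchange b a c d e, exchange c a b d e, exchange d a b c e, exchange e a b c d].flatMap
        fun p => withSquares (normalize p) (others [a, b, c, d, e])
    | _ => []

/-- The elements whose leading part has five letters, a further letter `p` and its second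
derivative, times squares. -/
def quinticsWithDouble : List Poly :=
  (choices 5).flatMap fun
    | [a, b, c, d, e] => (others [a, b, c, d, e]).flatMap fun p =>
      withSquares (normalize (extend (extend [(1, [a, b, p])] c d) e p))
        (others [a, b, c, d, e, p])
    | _ => []

/-- The products of six letters with a seventh letter and its first two derivatives. -/
def sexticsWithTriple : List Poly :=
  (choices 6).flatMap fun
    | [a, b, c, d, e, f] => (others [a, b, c, d, e, f]).map fun p =>
      normalize (appendWord (extend (extend [(1, [a, b, p])] c d) e f) (squares [p]))
    | _ => []

/-- The multilinear elements of degree seven whose leading part has a second derivative. -/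
def septics : List Poly :=
  (List.range 7).flatMap fun a => match others [0, a] with
    | [c, d, e, f, g] => [normalize (extend (exchange a 0 c d e) f g)]
    | _ => []

/-- The multilinear elements of degree seven without second derivatives. -/
def septicCycles : List Poly :=
  (choices 2).flatMap fun
    | [c, a] => if c = 0 ∨ a < 3 then [] else
      (fun b => match others [a, b, c, 0] with
        | [d, e, f] => [normalize
            (extend (exchange a b c d e) 0 f ++ extend (exchange a b 0 d e) c f)]
        | _ => []) (if c = 1 then 2 else 1)
    | _ => []

/-- The polynomials whose derivatives, with the generators, form a basis. -/
def products : List Poly :=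
  cubics ++ quintics ++ quinticsWithDouble ++ sexticsWithTriple ++ septics ++ septicCycles

/-- The bitmasks of the leading words of a basis of the closure of the generators. -/
def basisKeys : List ℕ :=
  (List.range 7).map (2 ^ ·) ++ products.map fun p => raiseKey (lead p).1

/-- The excess of a letter: one minus twice the number of derivatives. -/
def letterExcess (n : ℕ) : ℤ := 1 - 2 * (n / 7 : ℕ)

/-- The excess of a word: its degree minus twice its weight. -/
def excess (w : List ℕ) : ℤ := (w.map letterExcess).sum

/-- The sublists of a list with a given excess. -/
def subsetsOfExcess : List ℕ → ℤ → List (List ℕ)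
  | [], t => if t = 0 then [[]] else []
  | n :: w, t =>
    if ((n :: w).countP (· < 7) : ℤ) < t then [] else
      subsetsOfExcess w t ++ (subsetsOfExcess w (t - letterExcess n)).map (n :: ·)

/-- Polynomials of excess `3` with linearly independent images under `lower`. -/
def pivots : List Poly :=
  ((choices 5).flatMap fun
    | a :: w => withSquares [(1, (a + 7) :: w)] (others (a :: w))
    | _ => []) ++
  [[(1, [7, 8, 2, 3, 4, 5, 6])], [(1, [7, 1, 9, 3, 4, 5, 6])], [(1, [7, 1, 2, 10, 4, 5, 6])],
    [(1, [7, 1, 2, 3, 11, 5, 6])], [(1, [7, 1, 2, 3, 4, 12, 6])], [(1, [7, 1, 2, 3, 4, 5, 13])],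
    [(1, [7, 8, 2, 3, 4, 5, 6]), (1, [7, 1, 9, 3, 4, 5, 6]), (2, [0, 8, 9, 3, 4, 5, 6])],
    [(1, [14, 1, 2, 3, 4, 5, 6])]]

/-- The images of the pivots under `lower`. -/
def pivotImages : List Poly := pivots.map fun p => normalize (derive lower p)

/-! ### Evaluation of words -/

/-- The generator with letter `n`. -/
noncomputable def letter (n : ℕ) : Gr := gen (n % 7) (n / 7)

/-- The product of the letters of a word. -/
noncomputable def mono (w : List ℕ) : Gr := (w.map letter).prod

/-- The element of the Grassmann algebra given by a polynomial. -/
noncomputable def eval (p : Poly) : Gr := (p.map fun t => (t.1 : ZMod 3) • mono t.2).sum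

@[simp] theorem mono_nil : mono [] = 1 := rfl

@[simp] theorem mono_cons (n : ℕ) (w : List ℕ) : mono (n :: w) = letter n * mono w := by
  simp [mono]

@[simp] theorem mono_append (v w : List ℕ) : mono (v ++ w) = mono v * mono w := by
  simp [mono]

@[simp] theorem eval_nil : eval [] = 0 := rfl

@[simp] theorem eval_cons (t : ℕ × List ℕ) (p : Poly) :
    eval (t :: p) = (t.1 : ZMod 3) • mono t.2 + eval p := by
  simp [eval]

@[simp] theorem eval_append (p q : Poly) : eval (p ++ q) = eval p + eval q := by
  simp [eval]

theorem letter_mul_self (n : ℕ) : letter n * letter n = 0 :=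
  ExteriorAlgebra.ι_sq_zero _

theorem letter_mul_swap (m n : ℕ) : letter m * letter n = -(letter n * letter m) :=
  eq_neg_of_add_eq_zero_left (ExteriorAlgebra.ι_add_mul_swap _ _)

theorem letter_mul_left_swap (m n : ℕ) (x : Gr) :
    letter m * (letter n * x) = -(letter n * (letter m * x)) := by
  rw [← mul_assoc, letter_mul_swap, neg_mul, mul_assoc]

theorem letter_mul_self_left (n : ℕ) (x : Gr) : letter n * (letter n * x) = 0 := by
  rw [← mul_assoc, letter_mul_self, zero_mul]

/-! ### Evaluation of the operations on polynomials -/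

theorem eval_consLetter (n : ℕ) (p : Poly) : eval (consLetter n p) = letter n * eval p := by
  induction p with
  | nil => simp [consLetter]
  | cons t p ih => simp_all [consLetter, mul_add]

theorem eval_appendWord (p : Poly) (v : List ℕ) : eval (appendWord p v) = eval p * mono v := by
  induction p with
  | nil => simp [appendWord]
  | cons t p ih => simp_all [appendWord, add_mul]

theorem eval_map_smul (c : ℕ) (p : Poly) :
    eval (p.map fun u => (c * u.1, u.2)) = (c : ZMod 3) • eval p := by
  induction p with
  | nil => simp
  | cons t p ih => simp_all [smul_smul]

theorem map_one_eq_zero {D : Gr →ₗ[ZMod 3] Gr}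
    (hD : ∀ u v : Gr, D (u * v) = D u * v + u * D v) : D 1 = 0 := by
  simpa using hD 1 1

theorem eval_deriveWord {D : Gr →ₗ[ZMod 3] Gr} {φ : ℕ → List (ℕ × ℕ)}
    (hD : ∀ u v : Gr, D (u * v) = D u * v + u * D v)
    (hφ : ∀ n, D (letter n) = ((φ n).map fun t => (t.1 : ZMod 3) • letter t.2).sum)
    (w : List ℕ) : eval (deriveWord φ w) = D (mono w) := by
  induction w with
  | nil => simp [deriveWord, map_one_eq_zero hD]
  | cons n w ih =>
    have h : ∀ l : List (ℕ × ℕ), eval (l.map fun t => (t.1, t.2 :: w)) =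
        (l.map fun t => (t.1 : ZMod 3) • letter t.2).sum * mono w := by
      intro l
      induction l with
      | nil => simp
      | cons t l ih => simp_all [add_mul]
    rw [deriveWord, eval_append, eval_consLetter, ih, h, mono_cons, hD, hφ]

theorem eval_derive {D : Gr →ₗ[ZMod 3] Gr} {φ : ℕ → List (ℕ × ℕ)}
    (hD : ∀ u v : Gr, D (u * v) = D u * v + u * D v)
    (hφ : ∀ n, D (letter n) = ((φ n).map fun t => (t.1 : ZMod 3) • letter t.2).sum)
    (p : Poly) : eval (derive φ p) = D (eval p) := by
  induction p with
  | nil => simp [derive]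
  | cons t p ih =>
    have h : derive φ (t :: p) =
      (deriveWord φ t.2).map (fun u => (t.1 * u.1, u.2)) ++ derive φ p := by simp [derive]
    rw [h, eval_append, eval_map_smul, eval_deriveWord hD hφ, ih, eval_cons, map_add, map_smul]

theorem mono_insertLetter (n : ℕ) (w : List ℕ) :
    ((insertLetter n w).1 : ZMod 3) • mono (insertLetter n w).2 = letter n * mono w := by
  induction w with
  | nil => simp [insertLetter]
  | cons m w ih =>
    rw [insertLetter]
    split_ifs with h h'
    · simp
    · simp [h', letter_mul_self_left]
    · have h2 : (2 : ZMod 3) = -1 := by decide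
      rw [mono_cons, mono_cons, letter_mul_left_swap, ← ih]
      simp [h2]

theorem mono_sortWord (w : List ℕ) :
    ((sortWord w).1 : ZMod 3) • mono (sortWord w).2 = mono w := by
  induction w with
  | nil => simp [sortWord]
  | cons n w ih =>
    rw [sortWord, Nat.cast_mul, mul_smul, mono_insertLetter, mono_cons, ← mul_smul_comm, ih]

theorem eval_addTerm (t : ℕ × List ℕ) (p : Poly) :
    eval (addTerm t p) = (t.1 : ZMod 3) • mono t.2 + eval p := by
  induction p with
  | nil => simp [addTerm]
  | cons u p ih =>
    rw [addTerm]
    split_ifs with h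
    · simp [h, add_smul, add_assoc]
    · rw [eval_cons, ih, eval_cons, add_left_comm]

theorem eval_filter (p : Poly) : eval (p.filter fun t => t.1 % 3 ≠ 0) = eval p := by
  induction p with
  | nil => simp
  | cons t p ih =>
    by_cases h : t.1 % 3 = 0
    · have h0 : (t.1 : ZMod 3) = 0 := (ZMod.natCast_eq_zero_iff _ _).2 (Nat.dvd_of_mod_eq_zero h)
      simpa [h, h0] using ih
    · simpa [h] using ih

theorem eval_normalize (p : Poly) : eval (normalize p) = eval p := by
  rw [normalize, eval_filter]
  induction p with
  | nil => simp
  | cons t p ih =>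
    rw [List.foldr_cons, eval_addTerm, ih, eval_cons, Nat.cast_mul, mul_smul, mono_sortWord]

/-! ### Independence of words -/

theorem mono_perm {v w : List ℕ} (h : v.Perm w) : mono v = mono w ∨ mono v = -mono w := by
  induction h with
  | nil => simp
  | cons n _ ih => rcases ih with h | h <;> simp [h]
  | swap m n w => right; simp only [mono_cons]; exact letter_mul_left_swap _ _ _
  | trans _ _ h₁ h₂ => rcases h₁ with h₁ | h₁ <;> rcases h₂ with h₂ | h₂ <;> simp [h₁, h₂]

theorem mono_eq_zero {w : List ℕ} (h : ¬w.Nodup) : mono w = 0 := by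
  induction w with
  | nil => simp at h
  | cons n w ih =>
    by_cases hn : n ∈ w
    · rcases mono_perm (List.perm_cons_erase hn) with h' | h' <;>
        simp [h', letter_mul_self_left]
    · rw [mono_cons, ih fun h' => h (List.nodup_cons.2 ⟨hn, h'⟩), mul_zero]

/-- The generators as a basis indexed by a linear order. -/
noncomputable def vectorBasis :
    Module.Basis (ℕ ×ₗ ℕ) (ZMod 3) ((ℕ × ℕ) →₀ ZMod 3) :=
  Finsupp.basisSingleOne.reindex toLex

/-- The position of a letter in the basis of generators. -/
def position (n : ℕ) : ℕ ×ₗ ℕ := toLex (n % 7, n / 7)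

theorem position_injective : Function.Injective position := by
  intro m n h
  have h' : (m % 7, m / 7) = (n % 7, n / 7) := h
  rw [Prod.mk.injEq] at h'
  omega

theorem letter_eq (n : ℕ) : letter n = ExteriorAlgebra.ι (ZMod 3) (vectorBasis (position n)) := by
  simp [letter, vectorBasis, position]

theorem exists_basis_eq_mono (w : List ℕ) (hw : w.Nodup) :
    vectorBasis.ExteriorAlgebra (w.toFinset.map ⟨position, position_injective⟩) = mono w ∨
      vectorBasis.ExteriorAlgebra (w.toFinset.map ⟨position, position_injective⟩) = -mono w := by
  set s := w.toFinset.map ⟨position, position_injective⟩ with hs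
  have hmem : ∀ i : Fin s.card, ∃ n ∈ w, position n = s.orderEmbOfFin rfl i := by
    intro i
    obtain ⟨n, hn, h⟩ := Finset.mem_map.1 (s.orderEmbOfFin_mem rfl i)
    exact ⟨n, List.mem_toFinset.1 hn, h⟩
  choose m hm hpos using hmem
  have hinj : Function.Injective m := by
    intro i j hij
    apply (s.orderEmbOfFin rfl).injective
    rw [← hpos, ← hpos, hij]
  have hperm : (List.ofFn m).Perm w := by
    rw [List.perm_ext_iff_of_nodup (List.nodup_ofFn.2 hinj) hw]
    intro n
    rw [List.mem_ofFn]
    refine ⟨?_, fun hn => ?_⟩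
    · rintro ⟨i, rfl⟩
      exact hm i
    · have hn' : position n ∈ Set.range (s.orderEmbOfFin rfl) := by
        rw [Finset.range_orderEmbOfFin]
        simpa [hs, position_injective.eq_iff] using hn
      obtain ⟨i, hi⟩ := hn'
      exact ⟨i, position_injective ((hpos i).trans hi)⟩
  have heq : vectorBasis.ExteriorAlgebra s = mono (List.ofFn m) := by
    rw [ExteriorAlgebra.basis_apply_ofCard vectorBasis (rfl : s.card = s.card),
      ExteriorAlgebra.ιMulti_family, ExteriorAlgebra.ιMulti_apply, mono, List.map_ofFn]
    congr 2
    funext i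
    simp only [Function.comp_apply, letter_eq, hpos]
    rfl
  rw [heq]
  exact mono_perm hperm

theorem key_perm {v w : List ℕ} (h : v.Perm w) : key v = key w :=
  (h.map _).sum_eq

@[simp] theorem key_cons (n : ℕ) (w : List ℕ) : key (n :: w) = 2 ^ n + key w := by simp [key]

/-- The span of the words whose bitmask is less than `k`. -/
noncomputable def below (k : ℕ) : Submodule (ZMod 3) Gr :=
  Submodule.span (ZMod 3) {x | ∃ w, key w < k ∧ mono w = x}

theorem mono_mem_below {w : List ℕ} {k : ℕ} (h : key w < k) : mono w ∈ below k :=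
  Submodule.subset_span ⟨w, h, rfl⟩

theorem below_mono {j k : ℕ} (h : j ≤ k) : below j ≤ below k :=
  Submodule.span_mono fun _ ⟨w, hw, hx⟩ => ⟨w, hw.trans_le h, hx⟩

theorem mono_notMem_below {w : List ℕ} (hw : w.Nodup) : mono w ∉ below (key w) := by
  intro hmem
  set s := w.toFinset.map ⟨position, position_injective⟩ with hs
  have hker : below (key w) ≤ LinearMap.ker (vectorBasis.ExteriorAlgebra.coord s) := by
    refine Submodule.span_le.2 ?_
    rintro _ ⟨v, hv, rfl⟩
    by_cases hnd : v.Nodup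
    · have hne : v.toFinset.map ⟨position, position_injective⟩ ≠ s := by
        intro h
        refine hv.ne (key_perm ?_)
        rw [List.perm_ext_iff_of_nodup hnd hw]
        intro n
        have := Finset.ext_iff.1 (Finset.map_injective _ (h.trans hs)) n
        simpa using this
      rcases exists_basis_eq_mono v hnd with h | h
      · simp [← h, hne]
      · simp [← neg_eq_iff_eq_neg.2 h, hne]
    · simp [mono_eq_zero hnd]
  have h0 := hker hmem
  rcases exists_basis_eq_mono w hw with h | h
  · simp [← h, ← hs] at h0
  · simp [← neg_eq_iff_eq_neg.2 h, ← hs] at h0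

/-- The element `x` has a leading word, with bitmask `k`. -/
def HasLead (k : ℕ) (x : Gr) : Prop :=
  ∃ (c : ZMod 3) (w : List ℕ), c ≠ 0 ∧ w.Nodup ∧ key w = k ∧ x - c • mono w ∈ below k

theorem HasLead.mem_below {k : ℕ} {x : Gr} (h : HasLead k x) : x ∈ below (k + 1) := by
  obtain ⟨c, w, -, -, hk, hx⟩ := h
  have := add_mem (below_mono k.le_succ hx)
    (Submodule.smul_mem _ c (mono_mem_below (w := w) (k := k + 1) (by omega)))
  simpa using this

theorem HasLead.notMem_below {k : ℕ} {x : Gr} (h : HasLead k x) : x ∉ below k := by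
  obtain ⟨c, w, hc, hw, rfl, hx⟩ := h
  intro hmem
  have h' : c • mono w ∈ below (key w) := by simpa using sub_mem hmem hx
  exact mono_notMem_below hw ((Submodule.smul_mem_iff _ hc).1 h')

theorem linearIndependent_of_hasLead {ι : Type*} {k : ι → ℕ} {x : ι → Gr}
    (hk : Function.Injective k) (hx : ∀ i, HasLead (k i) (x i)) :
    LinearIndependent (ZMod 3) x := by
  classical
  rw [linearIndependent_iff']
  intro s c hsum
  by_contra! hne
  obtain ⟨i₀, hi₀, hc₀⟩ := hne
  obtain ⟨i, hi, hmax⟩ := (s.filter fun i => c i ≠ 0).exists_max_image k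
    ⟨i₀, Finset.mem_filter.2 ⟨hi₀, hc₀⟩⟩
  rw [Finset.mem_filter] at hi
  rw [← Finset.add_sum_erase s _ hi.1] at hsum
  have hrest : ∑ j ∈ s.erase i, c j • x j ∈ below (k i) := by
    refine sum_mem fun j hj => ?_
    rw [Finset.mem_erase] at hj
    by_cases hcj : c j = 0
    · simp [hcj]
    · have hlt : k j < k i := lt_of_le_of_ne (hmax j (Finset.mem_filter.2 ⟨hj.2, hcj⟩))
        fun h => hj.1 (hk h)
      exact Submodule.smul_mem _ _ (below_mono hlt (hx j).mem_below)
  have hmem : c i • x i ∈ below (k i) := by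
    rw [eq_neg_of_add_eq_zero_left hsum]
    exact neg_mem hrest
  exact (hx i).notMem_below ((Submodule.smul_mem_iff _ hi.2).1 hmem)

theorem length_le_finrank {l : List (ℕ × Gr)} {p : Submodule (ZMod 3) Gr}
    [Module.Finite (ZMod 3) p] (hl : (l.map Prod.fst).Nodup)
    (hlead : ∀ t ∈ l, HasLead t.1 t.2) (hmem : ∀ t ∈ l, t.2 ∈ p) :
    l.length ≤ Module.finrank (ZMod 3) p := by
  have hinj : Function.Injective fun i : Fin l.length => (l.get i).1 := by
    intro i j hij
    have h := List.nodup_iff_injective_get.1 hl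
    have := @h (i.cast (by simp)) (j.cast (by simp)) (by simpa using hij)
    simpa [Fin.ext_iff] using this
  have hli : LinearIndependent (ZMod 3)
      fun i : Fin l.length => (⟨(l.get i).2, hmem _ (l.get_mem i)⟩ : p) :=
    LinearIndependent.of_comp p.subtype
      (linearIndependent_of_hasLead hinj fun i => hlead _ (l.get_mem i))
  simpa using hli.fintype_card_le_finrank

theorem eval_mem_below_lead (p : Poly) : eval p ∈ below ((lead p).1 + 1) := by
  induction p with
  | nil => simp
  | cons t p ih =>
    have key_le : key t.2 ≤ (lead (t :: p)).1 ∧ (lead p).1 ≤ (lead (t :: p)).1 := by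
      rw [lead]
      rcases h : Nat.blt (lead p).1 (key t.2) with _ | _
      · have hle : key t.2 ≤ (lead p).1 :=
          not_lt.1 fun hlt => Bool.false_ne_true (h.symm.trans (Nat.blt_eq.mpr hlt))
        rcases h' : Nat.beq (lead p).1 (key t.2) with _ | _ <;> simp_all
      · simp_all [le_of_lt]
    exact add_mem (Submodule.smul_mem _ _ (mono_mem_below (by omega)))
      (below_mono (by omega) ih)

theorem hasLead_eval (p : Poly) (hp : (lead p).2 = true) : HasLead (lead p).1 (eval p) := by
  induction p with
  | nil => simp [lead] at hp
  | cons t p ih =>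
    rw [lead] at hp ⊢
    rcases h : Nat.blt (lead p).1 (key t.2) with _ | _
    · rcases h' : Nat.beq (lead p).1 (key t.2) with _ | _
      · simp only [h, h', cond_false] at hp ⊢
        obtain ⟨c, w, hc, hw, hk, hx⟩ := ih hp
        refine ⟨c, w, hc, hw, hk, ?_⟩
        have hlt : key t.2 < (lead p).1 := by
          have h₁ : ¬(lead p).1 < key t.2 := fun hlt =>
            Bool.false_ne_true (h.symm.trans (Nat.blt_eq.mpr hlt))
          have h₂ : (lead p).1 ≠ key t.2 := fun heq =>
            Bool.false_ne_true (h'.symm.trans (Nat.beq_eq.mpr heq))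
          omega
        rw [eval_cons, add_sub_assoc]
        exact add_mem (Submodule.smul_mem _ _ (mono_mem_below hlt)) hx
      · simp [h, h'] at hp
    · simp only [h, cond_true, Bool.and_eq_true, decide_eq_true_eq] at hp ⊢
      refine ⟨t.1, t.2, ?_, hp.2, rfl, ?_⟩
      · rw [Ne, ZMod.natCast_eq_zero_iff, Nat.dvd_iff_mod_eq_zero]
        exact hp.1
      · have hlt : (lead p).1 < key t.2 := by simpa using h
        simpa using below_mono (Nat.succ_le_of_lt hlt) (eval_mem_below_lead p)

theorem nodup_of_distinctMod (b : ℕ) (l : List ℕ) (h : distinctMod b l = true) : l.Nodup := by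
  induction b generalizing l with
  | zero =>
    match l with
    | [] => simp
    | [_] => simp
    | _ :: _ :: _ => simp [distinctMod] at h
  | succ b ih =>
    match l with
    | [] => simp
    | [_] => simp
    | j :: k :: l =>
      rw [distinctMod, Bool.and_eq_true] at h
      · have h₁ := ih _ h.1
        have h₂ := ih _ h.2
        generalize j :: k :: l = l at h₁ h₂
        rw [List.nodup_iff_count_le_one] at h₁ h₂ ⊢
        intro a
        by_cases ha : Nat.testBit a b = true
        · simpa [List.count_filter, ha] using h₁ a
        · simpa [List.count_filter, ha] using h₂ a
      all_goals simp

/-! ### Leading words under the derivation -/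

theorem letter_mul_mem_below (n : ℕ) {k : ℕ} {x : Gr} (hx : x ∈ below k) :
    letter n * x ∈ below (2 ^ n + k) := by
  have h : below k ≤ (below (2 ^ n + k)).comap (LinearMap.mulLeft (ZMod 3) (letter n)) := by
    refine Submodule.span_le.2 ?_
    rintro _ ⟨w, hw, rfl⟩
    have : mono (n :: w) ∈ below (2 ^ n + k) := mono_mem_below (by simpa using hw)
    simpa using this
  exact h hx

theorem key_lt_two_pow {w : List ℕ} {b : ℕ} (hw : w.Nodup) (h : ∀ n ∈ w, n < b) :
    key w < 2 ^ b := by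
  rw [key, ← List.sum_toFinset _ hw]
  exact Nat.geomSum_lt le_rfl (by simpa using h)

theorem two_pow_le_key {w : List ℕ} {n : ℕ} (h : n ∈ w) : 2 ^ n ≤ key w := by
  rw [key_perm (List.perm_cons_erase h), key_cons]
  omega

theorem map_mono_mem_below {d : Gr →ₗ[ZMod 3] Gr}
    (hLeib : ∀ u v : Gr, d (u * v) = d u * v + u * d v)
    (hd : ∀ n, d (letter n) = letter (n + 7)) (w : List ℕ) (k : ℕ) (h : ∀ m ∈ w, key w + 127 * 2 ^ m < k) :
    d (mono w) ∈ below k := by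
  induction w generalizing k with
  | nil => simp [map_one_eq_zero hLeib]
  | cons n w ih =>
    rw [mono_cons, hLeib, hd, ← mono_cons]
    have hn := h n (by simp)
    rw [key_cons] at hn
    refine add_mem (mono_mem_below ?_) ?_
    · rw [key_cons, pow_add]
      omega
    · have := letter_mul_mem_below n (ih (k - 2 ^ n) fun m hm => by
        have := h m (by simp [hm])
        rw [key_cons] at this
        omega)
      rwa [show 2 ^ n + (k - 2 ^ n) = k by omega] at this

theorem HasLead.map {d : Gr →ₗ[ZMod 3] Gr}
    (hLeib : ∀ u v : Gr, d (u * v) = d u * v + u * d v)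
    (hd : ∀ n, d (letter n) = letter (n + 7)) {k : ℕ} {x : Gr} (hk : 0 < k) (h : HasLead k x) :
    HasLead (raiseKey k) (d x) := by
  obtain ⟨c, w, hc, hw, rfl, hx⟩ := h
  have hne : w ≠ [] := by
    rintro rfl
    simp [key] at hk
  obtain ⟨n, hn, hmax⟩ := w.toFinset.exists_max_image id (by simpa using hne)
  simp only [List.mem_toFinset, id] at hn hmax
  have hlt : key w < 2 ^ (n + 1) :=
    key_lt_two_pow hw fun m hm => Nat.lt_succ_of_le (hmax m hm)
  have hlog : Nat.log2 (key w) = n :=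
    (Nat.log2_eq_iff hk.ne').2 ⟨two_pow_le_key hn, hlt⟩
  have hperm := List.perm_cons_erase hn
  have hnd := hperm.nodup_iff.1 hw
  rw [List.nodup_cons] at hnd
  have hltn : ∀ m ∈ w.erase n, m < n := fun m hm =>
    lt_of_le_of_ne (hmax m (List.mem_of_mem_erase hm)) fun h => hnd.1 (h ▸ hm)
  have hkey : key w = 2 ^ n + key (w.erase n) := by rw [key_perm hperm, key_cons]
  obtain ⟨c', hc', hmono⟩ : ∃ c' : ZMod 3, c' ≠ 0 ∧ c • mono w = c' • mono (n :: w.erase n) := by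
    rcases mono_perm hperm with h | h
    · exact ⟨c, hc, by rw [h]⟩
    · exact ⟨-c, neg_ne_zero.2 hc, by rw [h, smul_neg, neg_smul]⟩
  refine ⟨c', (n + 7) :: w.erase n, hc', ?_, ?_, ?_⟩
  · refine List.nodup_cons.2 ⟨fun h => ?_, hnd.2⟩
    have := hltn _ h
    omega
  · rw [raiseKey, hlog, key_cons, hkey, pow_add]
    omega
  · have hrest : d (x - c • mono w) ∈ below (raiseKey (key w)) := by
      have hle : below (key w) ≤ (below (raiseKey (key w))).comap d := by
        refine Submodule.span_le.2 ?_
        rintro _ ⟨v, hv, rfl⟩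
        refine map_mono_mem_below hLeib hd v _ fun m hm => ?_
        have hm' : m < n + 1 :=
          (Nat.pow_lt_pow_iff_right (by norm_num)).1 ((two_pow_le_key hm).trans_lt (hv.trans hlt))
        have : 2 ^ m ≤ 2 ^ n := Nat.pow_le_pow_right (by norm_num) (Nat.le_of_lt_succ hm')
        rw [raiseKey, hlog]
        omega
      exact hle hx
    have htail : letter n * d (mono (w.erase n)) ∈ below (raiseKey (key w)) := by
      have := letter_mul_mem_below n (map_mono_mem_below hLeib hd (w.erase n)
        (key (w.erase n) + 127 * 2 ^ n) fun m hm => by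
          have : 2 ^ m < 2 ^ n := Nat.pow_lt_pow_right (by norm_num) (hltn m hm)
          omega)
      rwa [show 2 ^ n + (key (w.erase n) + 127 * 2 ^ n) = raiseKey (key w) by
        rw [raiseKey, hlog, hkey, add_assoc]] at this
    have hsplit : d x - c' • mono ((n + 7) :: w.erase n) =
        d (x - c • mono w) + c' • (letter n * d (mono (w.erase n))) := by
      rw [hmono, map_sub, map_smul, mono_cons, mono_cons, hLeib, hd, smul_add]
      abel
    rw [hsplit]
    exact add_mem hrest (Submodule.smul_mem _ _ htail)

/-! ### Derivations -/

theorem exists_derivation {R M : Type*} [CommRing R] [AddCommGroup M] [Module R M]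
    (f : M →ₗ[R] M) : ∃ D : ExteriorAlgebra R M →ₗ[R] ExteriorAlgebra R M,
      (∀ u v, D (u * v) = D u * v + u * D v) ∧
        ∀ v, D (ExteriorAlgebra.ι R v) = ExteriorAlgebra.ι R (f v) := by
  let φ : M →ₗ[R] TrivSqZeroExt (ExteriorAlgebra R M) (ExteriorAlgebra R M) :=
    (TrivSqZeroExt.inlAlgHom R _ _).toLinearMap ∘ₗ ExteriorAlgebra.ι R +
      (TrivSqZeroExt.inrHom (ExteriorAlgebra R M) (ExteriorAlgebra R M)).restrictScalars R ∘ₗ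
        ExteriorAlgebra.ι R ∘ₗ f
  have hφ : ∀ v, φ v * φ v = 0 := by
    intro v
    ext
    · simp [φ]
    · simp [φ, ExteriorAlgebra.ι_add_mul_swap]
  let Φ := ExteriorAlgebra.lift R ⟨φ, hφ⟩
  have hfst : ∀ u, (Φ u).fst = u := by
    intro u
    have : (TrivSqZeroExt.fstHom R _ _).comp Φ = AlgHom.id R _ := by
      ext v
      simp [Φ, φ]
    exact DFunLike.congr_fun this u
  refine ⟨(TrivSqZeroExt.sndHom _ _).restrictScalars R ∘ₗ Φ.toLinearMap, fun u v => ?_,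
    fun v => ?_⟩
  · change (Φ (u * v)).snd = (Φ u).snd * v + u * (Φ v).snd
    rw [map_mul, TrivSqZeroExt.snd_mul, hfst, hfst, op_smul_eq_mul, smul_eq_mul, add_comm]
  · simp [Φ, φ]

theorem exists_lowering (c : ℕ → ℕ) (s : ℕ) (hc : ∀ j < s, c j = 0) :
    ∃ D : Gr →ₗ[ZMod 3] Gr, (∀ u v, D (u * v) = D u * v + u * D v) ∧
      ∀ n, D (letter n) = (c (n / 7) : ZMod 3) • letter (n - 7 * s) := by
  obtain ⟨D, hD, hι⟩ := exists_derivation (Finsupp.linearCombination (ZMod 3)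
    fun p : ℕ × ℕ => (c p.2 : ZMod 3) • Finsupp.single (p.1, p.2 - s) (1 : ZMod 3))
  refine ⟨D, hD, fun n => ?_⟩
  have hn : D (letter n) = (c (n / 7) : ZMod 3) • gen (n % 7) (n / 7 - s) := by
    rw [letter, gen, hι, Finsupp.linearCombination_single, one_smul, map_smul]
  rw [hn]
  rcases lt_or_ge (n / 7) s with h | h
  · simp [hc _ h]
  · rw [letter, show (n - 7 * s) % 7 = n % 7 by omega, show (n - 7 * s) / 7 = n / 7 - s by omega]

/-! ### Finite computations -/

theorem lead_products :
    products.all (fun p => (lead p).2 && Nat.blt 0 (lead p).1) = true := by decide +kernel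

theorem distinctMod_basisKeys : distinctMod 28 basisKeys = true := by decide +kernel

theorem length_basisKeys : basisKeys.length = 1014 := by decide +kernel

theorem length_subsetsOfExcess :
    (subsetsOfExcess (List.range 21).reverse 3).length = 1099 := by decide +kernel

theorem lead_pivotImages : pivotImages.all (fun p => (lead p).2) = true := by decide +kernel

theorem distinctMod_pivotImages : distinctMod 21 (pivotImages.map fun p => (lead p).1) = true := by
  decide +kernel

theorem length_pivotImages : pivotImages.length = 92 := by decide +kernel

theorem excess_pivots : ∀ p ∈ pivots, ∀ t ∈ p, excess t.2 = 3 := by decide +kernel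

theorem commutator_mono {D d E : Gr →ₗ[ZMod 3] Gr}
    (hD : ∀ u v, D (u * v) = D u * v + u * D v) (hLeib : ∀ u v, d (u * v) = d u * v + u * d v)
    (hE : ∀ u v, E (u * v) = E u * v + u * E v)
    (h : ∀ n, D (d (letter n)) = d (D (letter n)) + E (letter n)) (w : List ℕ) :
    D (d (mono w)) = d (D (mono w)) + E (mono w) := by
  induction w with
  | nil => simp [map_one_eq_zero hD, map_one_eq_zero hLeib, map_one_eq_zero hE]
  | cons n w ih =>
    simp only [mono_cons, hLeib, hD, hE, map_add, h, ih, mul_add, add_mul]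
    abel

/-! ### The grading by excess -/

@[simp] theorem excess_cons (n : ℕ) (w : List ℕ) :
    excess (n :: w) = letterExcess n + excess w := by simp [excess]

theorem excess_append (v w : List ℕ) : excess (v ++ w) = excess v + excess w := by simp [excess]

theorem excess_perm {v w : List ℕ} (h : v.Perm w) : excess v = excess w :=
  (h.map _).sum_eq

/-- The span of the words of excess `t`. -/
noncomputable def excessSpan (t : ℤ) : Submodule (ZMod 3) Gr :=
  Submodule.span (ZMod 3) {x | ∃ w, excess w = t ∧ mono w = x}

theorem mono_mem_excessSpan (w : List ℕ) : mono w ∈ excessSpan (excess w) :=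
  Submodule.subset_span ⟨w, rfl, rfl⟩

theorem mul_mem_excessSpan {s t : ℤ} {x y : Gr} (hx : x ∈ excessSpan s) (hy : y ∈ excessSpan t) :
    x * y ∈ excessSpan (s + t) := by
  have h : excessSpan s * excessSpan t ≤ excessSpan (s + t) := by
    rw [excessSpan, excessSpan, Submodule.span_mul_span, Submodule.span_le]
    rintro _ ⟨_, ⟨v, rfl, rfl⟩, _, ⟨w, rfl, rfl⟩, rfl⟩
    rw [← excess_append]
    simpa using mono_mem_excessSpan (v ++ w)
  exact h (Submodule.mul_mem_mul hx hy)

theorem map_mem_excessSpan {d : Gr →ₗ[ZMod 3] Gr}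
    (hLeib : ∀ u v : Gr, d (u * v) = d u * v + u * d v)
    (hd : ∀ n, d (letter n) = letter (n + 7)) {t : ℤ} {x : Gr} (hx : x ∈ excessSpan t) :
    d x ∈ excessSpan (t - 2) := by
  have h : excessSpan t ≤ (excessSpan (t - 2)).comap d := by
    refine Submodule.span_le.2 ?_
    rintro _ ⟨w, rfl, rfl⟩
    clear hx
    change d (mono w) ∈ excessSpan (excess w - 2)
    induction w with
    | nil => simp [map_one_eq_zero hLeib]
    | cons n w ih =>
      rw [mono_cons, hLeib, hd, ← mono_cons]
      refine add_mem ?_ ?_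
      · have h : excess (n :: w) - 2 = excess ((n + 7) :: w) := by
          simp only [excess_cons, letterExcess]
          omega
        rw [h]
        exact mono_mem_excessSpan _
      · rw [excess_cons, add_sub_assoc]
        refine mul_mem_excessSpan ?_ ih
        simpa [excess] using mono_mem_excessSpan [n]
  exact h hx

theorem weight_mono {E : Gr →ₗ[ZMod 3] Gr} (hE : ∀ u v, E (u * v) = E u * v + u * E v)
    (hEl : ∀ n, E (letter n) = ((1 + n / 7 : ℕ) : ZMod 3) • letter n) (w : List ℕ) :
    E (mono w) = (excess w : ZMod 3) • mono w := by
  induction w with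
  | nil => simp [map_one_eq_zero hE, excess]
  | cons n w ih =>
    have h3 : (3 : ZMod 3) = 0 := by decide
    have h : ((1 + n / 7 : ℕ) : ZMod 3) = (letterExcess n : ZMod 3) := by
      rw [letterExcess, Nat.cast_add, Nat.cast_one, Int.cast_sub, Int.cast_one, Int.cast_mul,
        Int.cast_ofNat, Int.cast_natCast]
      linear_combination ((n / 7 : ℕ) : ZMod 3) * h3
    rw [mono_cons, hE, hEl, ih, h, excess_cons, Int.cast_add, add_smul, smul_mul_assoc,
      mul_smul_comm]

/-! ### The dimension of the component of excess three -/

theorem excess_le_countP (w : List ℕ) : excess w ≤ w.countP (· < 7) := by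
  induction w with
  | nil => simp [excess]
  | cons n w ih =>
    rw [excess_cons, List.countP_cons, letterExcess]
    split_ifs with h
    · push_cast
      omega
    · simp only [decide_eq_true_eq] at h
      push_cast
      omega

theorem mem_subsetsOfExcess {v w : List ℕ} (h : v.Sublist w) :
    v ∈ subsetsOfExcess w (excess v) := by
  induction w generalizing v with
  | nil =>
    rw [List.sublist_nil] at h
    simp [h, subsetsOfExcess, excess]
  | cons n w ih =>
    have hle : ¬(((n :: w).countP (· < 7) : ℕ) : ℤ) < excess v :=
      not_lt.2 ((excess_le_countP v).trans (by exact_mod_cast h.countP_le))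
    rw [subsetsOfExcess, if_neg hle, List.mem_append]
    rcases List.sublist_cons_iff.1 h with h | ⟨v, rfl, h'⟩
    · exact Or.inl (ih h)
    · right
      rw [excess_cons, add_sub_cancel_left]
      exact List.mem_map_of_mem (ih h')

theorem lt_of_excess {w : List ℕ} (hw : w.Nodup) (h : 3 ≤ excess w) : ∀ n ∈ w, n < 21 := by
  intro n hn
  by_contra hlt
  have hperm := List.perm_cons_erase hn
  have hnd := (List.nodup_cons.1 (hperm.nodup_iff.1 hw)).2
  have hcount : (w.erase n).countP (· < 7) ≤ 7 := by
    rw [List.countP_eq_length_filter]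
    have : ((w.erase n).filter (· < 7)).Subperm (List.range 7) :=
      List.subperm_of_subset (hnd.filter _) fun m hm => by simpa using (List.mem_filter.1 hm).2
    simpa using this.length_le
  have hle := excess_le_countP (w.erase n)
  rw [excess_perm hperm, excess_cons, letterExcess] at h
  omega

theorem excessSpan_three_le : excessSpan 3 ≤ Submodule.span (ZMod 3)
    {x | x ∈ (subsetsOfExcess (List.range 21).reverse 3).map mono} := by
  refine Submodule.span_le.2 ?_
  rintro _ ⟨w, hw, rfl⟩
  by_cases hnd : w.Nodup
  · set v := (List.range 21).reverse.filter (· ∈ w) with hv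
    have hperm : w.Perm v := by
      refine (List.perm_ext_iff_of_nodup hnd
        ((List.nodup_reverse.2 List.nodup_range).filter _)).2 fun n => ?_
      have := lt_of_excess hnd hw.ge n
      simp only [List.mem_filter, List.mem_reverse, List.mem_range, decide_eq_true_eq]
      tauto
    have hmem : v ∈ subsetsOfExcess (List.range 21).reverse 3 := by
      rw [← hw, excess_perm hperm]
      exact mem_subsetsOfExcess List.filter_sublist
    have hmono := Submodule.subset_span (R := ZMod 3)
      (s := {x | x ∈ (subsetsOfExcess (List.range 21).reverse 3).map mono})
      (List.mem_map_of_mem hmem)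
    rcases mono_perm hperm with h | h
    · rwa [SetLike.mem_coe, h]
    · rw [SetLike.mem_coe, h]
      exact neg_mem hmono
  · simp [mono_eq_zero hnd]

theorem finite_span_list (l : List Gr) :
    Module.Finite (ZMod 3) (Submodule.span (ZMod 3) {x | x ∈ l}) :=
  Module.Finite.span_of_finite _ l.finite_toSet

theorem finrank_span_list_le (l : List Gr) :
    Module.finrank (ZMod 3) (Submodule.span (ZMod 3) {x | x ∈ l}) ≤ l.length := by
  have h := finrank_range_le_card (R := ZMod 3) l.get
  rwa [Set.finrank, Set.range_list_get, Fintype.card_fin] at h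

theorem finite_excessSpan_three : Module.Finite (ZMod 3) (excessSpan 3) := by
  have := finite_span_list ((subsetsOfExcess (List.range 21).reverse 3).map mono)
  exact Submodule.finiteDimensional_of_le excessSpan_three_le

theorem finrank_excessSpan_three_le : Module.finrank (ZMod 3) (excessSpan 3) ≤ 1099 := by
  have := finite_span_list ((subsetsOfExcess (List.range 21).reverse 3).map mono)
  refine (Submodule.finrank_mono excessSpan_three_le).trans ((finrank_span_list_le _).trans ?_)
  rw [List.length_map, length_subsetsOfExcess]

/-! ### The upper bound -/

/-- The elements of excess `t` in the kernel of both lowering derivations. -/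
noncomputable def highest (D₁ D₂ : Gr →ₗ[ZMod 3] Gr) (t : ℤ) : Submodule (ZMod 3) Gr :=
  excessSpan t ⊓ (LinearMap.ker D₁ ⊓ LinearMap.ker D₂)

theorem mul_mem_highest {D₁ D₂ : Gr →ₗ[ZMod 3] Gr}
    (h₁ : ∀ u v, D₁ (u * v) = D₁ u * v + u * D₁ v)
    (h₂ : ∀ u v, D₂ (u * v) = D₂ u * v + u * D₂ v) {s t : ℤ} {x y : Gr}
    (hx : x ∈ highest D₁ D₂ s) (hy : y ∈ highest D₁ D₂ t) : x * y ∈ highest D₁ D₂ (s + t) := by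
  obtain ⟨hx, hx₁, hx₂⟩ := hx
  obtain ⟨hy, hy₁, hy₂⟩ := hy
  rw [SetLike.mem_coe, LinearMap.mem_ker] at hx₁ hx₂ hy₁ hy₂
  refine ⟨mul_mem_excessSpan hx hy, ?_, ?_⟩ <;> rw [SetLike.mem_coe, LinearMap.mem_ker]
  · simp [h₁, hx₁, hy₁]
  · simp [h₂, hx₂, hy₂]

theorem finrank_highest_le {D₁ D₂ : Gr →ₗ[ZMod 3] Gr}
    (h₁ : ∀ u v, D₁ (u * v) = D₁ u * v + u * D₁ v)
    (h₂ : ∀ u v, D₂ (u * v) = D₂ u * v + u * D₂ v)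
    (hl₁ : ∀ n, D₁ (letter n) = (lowerCoeff (n / 7) : ZMod 3) • letter (n - 7))
    (hl₂ : ∀ n, D₂ (letter n) = (lowerTwoCoeff (n / 7) : ZMod 3) • letter (n - 14)) :
    Module.finrank (ZMod 3) (highest D₁ D₂ 3) ≤ 1007 := by
  have hfin := finite_excessSpan_three
  set f := (D₁ + D₂).domRestrict (excessSpan 3) with hf
  have hrange : 92 ≤ Module.finrank (ZMod 3) (LinearMap.range f) := by
    have := length_le_finrank (p := LinearMap.range f)
      (l := pivotImages.map fun p => ((lead p).1, eval p)) ?_ ?_ ?_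
    · rwa [List.length_map, length_pivotImages] at this
    · rw [List.map_map]
      exact nodup_of_distinctMod _ _ distinctMod_pivotImages
    · simp only [List.mem_map, forall_exists_index, and_imp, forall_apply_eq_imp_iff₂]
      exact fun p hp => hasLead_eval p (List.all_eq_true.1 lead_pivotImages p hp)
    · simp only [List.mem_map, forall_exists_index, and_imp, forall_apply_eq_imp_iff₂]
      intro p hp
      obtain ⟨q, hq, rfl⟩ := List.mem_map.1 hp
      have hmem : eval q ∈ excessSpan 3 := by
        refine list_sum_mem fun x hx => ?_
        obtain ⟨t, ht, rfl⟩ := List.mem_map.1 hx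
        rw [← excess_pivots q hq t ht]
        exact Submodule.smul_mem _ _ (mono_mem_excessSpan _)
      refine ⟨⟨eval q, hmem⟩, ?_⟩
      rw [eval_normalize, eval_derive (D := D₁ + D₂)]
      · rfl
      · intro u v
        simp only [LinearMap.add_apply, h₁, h₂, add_mul, mul_add]
        abel
      · intro n
        simp [lower, hl₁, hl₂]
  have hle : highest D₁ D₂ 3 ≤ (LinearMap.ker f).map (excessSpan 3).subtype := by
    rintro x ⟨hx, hx₁, hx₂⟩
    rw [SetLike.mem_coe, LinearMap.mem_ker] at hx₁ hx₂
    exact ⟨⟨x, hx⟩, by simp [hf, hx₁, hx₂], rfl⟩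
  have hker := Submodule.finrank_mono hle
  rw [Submodule.finrank_map_subtype_eq] at hker
  have hsum := LinearMap.finrank_range_add_finrank_ker f
  have htotal := finrank_excessSpan_three_le
  omega

theorem lower_commutator {D₁ d E : Gr →ₗ[ZMod 3] Gr}
    (hl₁ : ∀ n, D₁ (letter n) = (lowerCoeff (n / 7) : ZMod 3) • letter (n - 7))
    (hd : ∀ n, d (letter n) = letter (n + 7))
    (hEl : ∀ n, E (letter n) = ((1 + n / 7 : ℕ) : ZMod 3) • letter n) (n : ℕ) :
    D₁ (d (letter n)) = d (D₁ (letter n)) + E (letter n) := by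
  rw [hd, hl₁, hl₁, hEl, map_smul, hd, show (n + 7) / 7 = n / 7 + 1 by omega]
  have hc : (lowerCoeff (n / 7 + 1) : ZMod 3) =
      (lowerCoeff (n / 7) : ZMod 3) + ((1 + n / 7 : ℕ) : ZMod 3) := by
    rw [← Nat.cast_add, ZMod.natCast_eq_natCast_iff']
    simp only [lowerCoeff]
    split_ifs <;> omega
  rw [hc, add_smul]
  rcases lt_or_ge n 7 with h | h
  · simp [Nat.div_eq_of_lt h, lowerCoeff]
  · rw [Nat.sub_add_cancel h, Nat.add_sub_cancel]

theorem lowerTwo_commutator {D₁ D₂ d : Gr →ₗ[ZMod 3] Gr}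
    (hl₁ : ∀ n, D₁ (letter n) = (lowerCoeff (n / 7) : ZMod 3) • letter (n - 7))
    (hl₂ : ∀ n, D₂ (letter n) = (lowerTwoCoeff (n / 7) : ZMod 3) • letter (n - 14))
    (hd : ∀ n, d (letter n) = letter (n + 7)) (n : ℕ) :
    D₂ (d (letter n)) = d (D₂ (letter n)) + D₁ (letter n) := by
  rw [hd, hl₂, hl₂, hl₁, map_smul, hd, show (n + 7) / 7 = n / 7 + 1 by omega,
    show n + 7 - 14 = n - 7 by omega]
  have hc : lowerTwoCoeff (n / 7 + 1) = lowerTwoCoeff (n / 7) + lowerCoeff (n / 7) := by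
    simp only [lowerCoeff, lowerTwoCoeff]
    split_ifs <;> omega
  rw [hc, Nat.cast_add, add_smul]
  rcases lt_or_ge n 14 with h | h
  · have h0 : lowerTwoCoeff (n / 7) = 0 := by
      rw [lowerTwoCoeff]
      omega
    simp [h0]
  · rw [show n - 14 + 7 = n - 7 by omega]

theorem eq_of_mem_excessSpan {f f' : Gr →ₗ[ZMod 3] Gr} {t : ℤ}
    (h : ∀ w, excess w = t → f (mono w) = f' (mono w)) {x : Gr} (hx : x ∈ excessSpan t) :
    f x = f' x := by
  refine LinearMap.eqOn_span (s := {x | ∃ w, excess w = t ∧ mono w = x}) ?_ hx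
  rintro _ ⟨w, hw, rfl⟩
  exact h w hw

theorem map_mem_highest {D₁ D₂ d : Gr →ₗ[ZMod 3] Gr}
    (h₁ : ∀ u v, D₁ (u * v) = D₁ u * v + u * D₁ v)
    (h₂ : ∀ u v, D₂ (u * v) = D₂ u * v + u * D₂ v)
    (hl₁ : ∀ n, D₁ (letter n) = (lowerCoeff (n / 7) : ZMod 3) • letter (n - 7))
    (hl₂ : ∀ n, D₂ (letter n) = (lowerTwoCoeff (n / 7) : ZMod 3) • letter (n - 14))
    (hLeib : ∀ u v : Gr, d (u * v) = d u * v + u * d v)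
    (hd : ∀ n, d (letter n) = letter (n + 7)) {x : Gr} (hx : x ∈ highest D₁ D₂ 3) :
    d x ∈ highest D₁ D₂ 1 := by
  obtain ⟨E, hE, hEl⟩ := exists_lowering (fun j => 1 + j) 0 (by simp)
  rw [highest, Submodule.mem_inf, Submodule.mem_inf, LinearMap.mem_ker, LinearMap.mem_ker] at hx ⊢
  obtain ⟨hx, hx₁, hx₂⟩ := hx
  have hdx := map_mem_excessSpan hLeib hd hx
  rw [show (3 - 2 : ℤ) = 1 by norm_num] at hdx
  refine ⟨hdx, ?_, ?_⟩
  · have h : (D₁ ∘ₗ d) x = (d ∘ₗ D₁) x := by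
      refine eq_of_mem_excessSpan (fun w hw => ?_) hx
      have h3 : ((3 : ℤ) : ZMod 3) = 0 := by decide
      rw [LinearMap.comp_apply, LinearMap.comp_apply,
        commutator_mono h₁ hLeib hE (lower_commutator hl₁ hd hEl), weight_mono hE hEl, hw, h3,
        zero_smul, add_zero]
    rw [LinearMap.comp_apply, LinearMap.comp_apply, hx₁, map_zero] at h
    exact h
  · have h : (D₂ ∘ₗ d) x = (d ∘ₗ D₂ + D₁) x :=
      eq_of_mem_excessSpan (fun w _ =>
        commutator_mono h₂ hLeib h₁ (lowerTwo_commutator hl₁ hl₂ hd) w) hx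
    rw [LinearMap.comp_apply, LinearMap.add_apply, LinearMap.comp_apply, hx₁, hx₂, map_zero,
      add_zero] at h
    exact h

theorem exists_finrank_le {d : Gr →ₗ[ZMod 3] Gr}
    (hLeib : ∀ u v : Gr, d (u * v) = d u * v + u * d v)
    (hd : ∀ n, d (letter n) = letter (n + 7)) :
    ∃ p : Submodule (ZMod 3) Gr, Module.Finite (ZMod 3) p ∧ Module.finrank (ZMod 3) p ≤ 1014 ∧
      (∀ i < 7, letter i ∈ p) ∧ ∀ x y z, x ∈ p → y ∈ p → z ∈ p → -d (x * y * z) ∈ p := by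
  obtain ⟨D₁, h₁, hl₁⟩ := exists_lowering lowerCoeff 1 (by
    intro j hj
    simp [Nat.lt_one_iff.1 hj, lowerCoeff])
  obtain ⟨D₂, h₂, hl₂⟩ := exists_lowering lowerTwoCoeff 2 (by
    intro j hj
    rw [lowerTwoCoeff]
    omega)
  rw [mul_one] at hl₁
  rw [show 7 * 2 = 14 by norm_num] at hl₂
  set l := (List.range 7).map letter with hl
  have hfin := finite_excessSpan_three
  have hfinl := finite_span_list l
  have hfin₃ : Module.Finite (ZMod 3) (highest D₁ D₂ 3) :=
    Submodule.finiteDimensional_of_le inf_le_left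
  have hletter : ∀ i < 7, letter i ∈ Submodule.span (ZMod 3) {x | x ∈ l} := fun i hi =>
    Submodule.subset_span (List.mem_map_of_mem (List.mem_range.2 hi))
  have hle : Submodule.span (ZMod 3) {x | x ∈ l} ⊔ (highest D₁ D₂ 3).map d ≤
      highest D₁ D₂ 1 := by
    refine sup_le (Submodule.span_le.2 ?_) ?_
    · intro x hx
      obtain ⟨i, hi, rfl⟩ := List.mem_map.1 hx
      have hi0 : i / 7 = 0 := Nat.div_eq_of_lt (List.mem_range.1 hi)
      rw [SetLike.mem_coe, highest, Submodule.mem_inf, Submodule.mem_inf, LinearMap.mem_ker,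
        LinearMap.mem_ker, hl₁, hl₂, hi0]
      refine ⟨?_, by simp [lowerCoeff], by simp [lowerTwoCoeff]⟩
      simpa [excess, letterExcess, hi0] using mono_mem_excessSpan [i]
    · rintro _ ⟨x, hx, rfl⟩
      exact map_mem_highest h₁ h₂ hl₁ hl₂ hLeib hd hx
  refine ⟨Submodule.span (ZMod 3) {x | x ∈ l} ⊔ (highest D₁ D₂ 3).map d, inferInstance, ?_,
    fun i hi => Submodule.mem_sup_left (hletter i hi), fun x y z hx hy hz => ?_⟩
  · have hsup := Submodule.finrank_add_le_finrank_add_finrank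
      (Submodule.span (ZMod 3) {x | x ∈ l}) ((highest D₁ D₂ 3).map d)
    have hlen : l.length = 7 := by rw [hl, List.length_map, List.length_range]
    have hspan := finrank_span_list_le l
    have hmap := Submodule.finrank_map_le d (highest D₁ D₂ 3)
    have hhigh := finrank_highest_le h₁ h₂ hl₁ hl₂
    omega
  · refine neg_mem (Submodule.mem_sup_right ⟨_, ?_, rfl⟩)
    have h := mul_mem_highest h₁ h₂ (mul_mem_highest h₁ h₂ (hle hx) (hle hy)) (hle hz)
    rw [show (1 + 1 + 1 : ℤ) = 3 by norm_num] at h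
    exact h

/-! ### The lower bound -/

/-- The span of the products of an element of `C` and two letters less than `7`. -/
noncomputable def pairSpan (C : Submodule (ZMod 3) Gr) : Submodule (ZMod 3) Gr :=
  Submodule.span (ZMod 3) {y | ∃ x ∈ C, ∃ j < 7, ∃ k < 7, x * letter j * letter k = y}

theorem mul_mul_mem_pairSpan {C : Submodule (ZMod 3) Gr} {x : Gr} (hx : x ∈ C) {j k : ℕ}
    (hj : j < 7) (hk : k < 7) : x * letter j * letter k ∈ pairSpan C :=
  Submodule.subset_span ⟨x, hx, j, hj, k, hk, rfl⟩

theorem mem_of_mem_subsets {v w : List ℕ} (h : v ∈ subsets w) {n : ℕ} (hn : n ∈ v) : n ∈ w := by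
  induction w generalizing v with
  | nil => simp_all [subsets]
  | cons m w ih =>
    rw [subsets, List.mem_append] at h
    rcases h with h | h
    · exact List.mem_cons_of_mem _ (ih h hn)
    · obtain ⟨u, hu, rfl⟩ := List.mem_map.1 h
      rcases List.mem_cons.1 hn with rfl | hn
      · exact List.mem_cons_self
      · exact List.mem_cons_of_mem _ (ih hu hn)

theorem lt_of_mem_choices {k : ℕ} {w : List ℕ} (h : w ∈ choices k) : ∀ n ∈ w, n < 7 :=
  fun _ hn => List.mem_range.1 (mem_of_mem_subsets (List.mem_filter.1 h).1 hn)

theorem lt_of_mem_others {w : List ℕ} : ∀ n ∈ others w, n < 7 :=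
  fun _ hn => List.mem_range.1 (List.mem_filter.1 hn).1

/-- The map `d` is the derivation raising letters, and `C` is a subspace containing the letters
less than `7` and closed under the ternary operation. -/
structure IsTernaryClosed (d : Gr →ₗ[ZMod 3] Gr) (C : Submodule (ZMod 3) Gr) : Prop where
  leibniz : ∀ u v : Gr, d (u * v) = d u * v + u * d v
  map_letter : ∀ n, d (letter n) = letter (n + 7)
  letter_mem : ∀ i < 7, letter i ∈ C
  neg_map_mem : ∀ x y z : Gr, x ∈ C → y ∈ C → z ∈ C → -d (x * y * z) ∈ C

namespace IsTernaryClosed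

variable {d : Gr →ₗ[ZMod 3] Gr} {C : Submodule (ZMod 3) Gr}

theorem map_mem (h : IsTernaryClosed d C) {y : Gr} (hy : y ∈ pairSpan C) : d y ∈ C := by
  have hle : pairSpan C ≤ C.comap d := by
    refine Submodule.span_le.2 ?_
    rintro _ ⟨x, hx, j, hj, k, hk, rfl⟩
    rw [SetLike.mem_coe, Submodule.mem_comap, ← neg_mem_iff]
    exact h.neg_map_mem _ _ _ hx (h.letter_mem j hj) (h.letter_mem k hk)
  exact hle hy

theorem mul_square_mem (h : IsTernaryClosed d C) {y : Gr} (hy : y ∈ pairSpan C) {q : ℕ} (hq : q < 7) :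
    y * (letter q * letter (q + 7)) ∈ pairSpan C := by
  have hle : pairSpan C ≤ (pairSpan C).comap
      (LinearMap.mulRight (ZMod 3) (letter q * letter (q + 7))) := by
    refine Submodule.span_le.2 ?_
    rintro _ ⟨x, hx, j, hj, k, hk, rfl⟩
    have hmem := mul_mul_mem_pairSpan (h.map_mem (mul_mul_mem_pairSpan hx hj hq)) hk hq
    have hzero : letter q * (letter k * letter q) = 0 := by
      rw [letter_mul_swap k, mul_neg, letter_mul_self_left, neg_zero]
    have hswap : letter (q + 7) * (letter k * letter q) =
        letter k * (letter q * letter (q + 7)) := by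
      rw [letter_mul_left_swap, letter_mul_swap (q + 7), mul_neg, neg_neg]
    have heq : d (x * letter j * letter q) * letter k * letter q =
        x * letter j * letter k * (letter q * letter (q + 7)) := by
      rw [h.leibniz, h.map_letter, add_mul, add_mul]
      simp only [mul_assoc, hzero, hswap, mul_zero, zero_add]
    rw [heq] at hmem
    exact hmem
  exact hle hy

theorem mul_squares_mem (h : IsTernaryClosed d C) {y : Gr} (hy : y ∈ pairSpan C) {v : List ℕ}
    (hv : ∀ q ∈ v, q < 7) : y * mono (squares v) ∈ pairSpan C := by
  induction v generalizing y with
  | nil => simpa [squares] using hy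
  | cons q v ih =>
    have hmem := ih (h.mul_square_mem hy (hv q (by simp))) fun r hr => hv r (by simp [hr])
    have heq : mono (squares (q :: v)) = letter q * letter (q + 7) * mono (squares v) := by
      simp [squares, mul_assoc]
    rwa [heq, ← mul_assoc]

theorem cubic_mem (h : IsTernaryClosed d C) {a b c : ℕ} (ha : a < 7) (hb : b < 7) (hc : c < 7) :
    eval [(1, [a, b, c])] ∈ pairSpan C := by
  simpa [mul_assoc] using mul_mul_mem_pairSpan (h.letter_mem a ha) hb hc

theorem extend_mem (h : IsTernaryClosed d C) {p : Poly} (hp : eval p ∈ pairSpan C) {j k : ℕ}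
    (hj : j < 7) (hk : k < 7) : eval (extend p j k) ∈ pairSpan C := by
  rw [extend, eval_appendWord, eval_derive h.leibniz fun n => by simp [raise, h.map_letter]]
  simpa [mul_assoc] using mul_mul_mem_pairSpan (h.map_mem hp) hj hk

theorem exchange_mem (h : IsTernaryClosed d C) {a b c k e : ℕ} (ha : a < 7) (hb : b < 7) (hc : c < 7)
    (hk : k < 7) (he : e < 7) : eval (exchange a b c k e) ∈ pairSpan C := by
  rw [exchange, eval_append]
  exact add_mem (h.extend_mem (h.cubic_mem ha hc hk) hb he)
    (h.extend_mem (h.cubic_mem hb hc hk) ha he)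

theorem withSquares_mem (h : IsTernaryClosed d C) {p q : Poly} {v : List ℕ} (hp : eval p ∈ pairSpan C)
    (hv : ∀ n ∈ v, n < 7) (hq : q ∈ withSquares p v) : eval q ∈ pairSpan C := by
  obtain ⟨u, hu, rfl⟩ := List.mem_map.1 hq
  rw [eval_appendWord]
  exact h.mul_squares_mem hp fun n hn => hv n (mem_of_mem_subsets hu hn)

theorem cubics_mem (h : IsTernaryClosed d C) {p : Poly} (hp : p ∈ cubics) : eval p ∈ pairSpan C := by
  obtain ⟨w, hw, hp⟩ := List.mem_flatMap.1 hp
  have hlen : w.length = 3 := by simpa using (List.mem_filter.1 hw).2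
  obtain ⟨a, b, c, rfl⟩ := List.length_eq_three.1 hlen
  have hlt := lt_of_mem_choices hw
  simp only [List.mem_cons, List.not_mem_nil, or_false, forall_eq_or_imp, forall_eq] at hlt
  obtain ⟨ha, hb, hc⟩ := hlt
  exact h.withSquares_mem (h.cubic_mem ha hb hc) lt_of_mem_others hp

theorem quintics_mem (h : IsTernaryClosed d C) {p : Poly} (hp : p ∈ quintics) :
    eval p ∈ pairSpan C := by
  obtain ⟨w, hw, hp⟩ := List.mem_flatMap.1 hp
  have hlt := lt_of_mem_choices hw
  split at hp
  · simp only [List.mem_cons, List.not_mem_nil, or_false, forall_eq_or_imp, forall_eq] at hlt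
    obtain ⟨ha, hb, hc, hk, he⟩ := hlt
    obtain ⟨q, hq, hp⟩ := List.mem_flatMap.1 hp
    refine h.withSquares_mem ?_ lt_of_mem_others hp
    rw [eval_normalize]
    simp only [List.mem_cons, List.not_mem_nil, or_false] at hq
    rcases hq with rfl | rfl | rfl | rfl <;> apply h.exchange_mem <;> assumption
  · simp at hp

theorem quinticsWithDouble_mem (h : IsTernaryClosed d C) {p : Poly} (hp : p ∈ quinticsWithDouble) :
    eval p ∈ pairSpan C := by
  obtain ⟨w, hw, hp⟩ := List.mem_flatMap.1 hp
  have hlt := lt_of_mem_choices hw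
  split at hp
  · simp only [List.mem_cons, List.not_mem_nil, or_false, forall_eq_or_imp, forall_eq] at hlt
    obtain ⟨ha, hb, hc, hk, he⟩ := hlt
    obtain ⟨q, hq, hp⟩ := List.mem_flatMap.1 hp
    have hq7 := lt_of_mem_others q hq
    refine h.withSquares_mem ?_ lt_of_mem_others hp
    rw [eval_normalize]
    exact h.extend_mem (h.extend_mem (h.cubic_mem ha hb hq7) hc hk) he hq7
  · simp at hp

theorem sexticsWithTriple_mem (h : IsTernaryClosed d C) {p : Poly} (hp : p ∈ sexticsWithTriple) :
    eval p ∈ pairSpan C := by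
  obtain ⟨w, hw, hp⟩ := List.mem_flatMap.1 hp
  have hlt := lt_of_mem_choices hw
  split at hp
  · simp only [List.mem_cons, List.not_mem_nil, or_false, forall_eq_or_imp, forall_eq] at hlt
    obtain ⟨ha, hb, hc, hk, he, hf⟩ := hlt
    obtain ⟨q, hq, rfl⟩ := List.mem_map.1 hp
    have hq7 := lt_of_mem_others q hq
    rw [eval_normalize, eval_appendWord]
    exact h.mul_squares_mem
      (h.extend_mem (h.extend_mem (h.cubic_mem ha hb hq7) hc hk) he hf) (by simpa using hq7)
  · simp at hp

theorem septics_mem (h : IsTernaryClosed d C) {p : Poly} (hp : p ∈ septics) : eval p ∈ pairSpan C := by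
  obtain ⟨a, ha, hp⟩ := List.mem_flatMap.1 hp
  rw [List.mem_range] at ha
  have hlt := lt_of_mem_others (w := [0, a])
  split at hp
  · rename_i hw
    rw [hw] at hlt
    simp only [List.mem_cons, List.not_mem_nil, or_false, forall_eq_or_imp, forall_eq] at hlt
    obtain ⟨hc, hk, he, hf, hg⟩ := hlt
    rw [List.mem_singleton.1 hp, eval_normalize]
    exact h.extend_mem (h.exchange_mem ha (by norm_num) hc hk he) hf hg
  · simp at hp

theorem septicCycles_mem (h : IsTernaryClosed d C) {p : Poly} (hp : p ∈ septicCycles) :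
    eval p ∈ pairSpan C := by
  obtain ⟨w, hw, hp⟩ := List.mem_flatMap.1 hp
  have hlt := lt_of_mem_choices hw
  split at hp
  · rename_i c a
    simp only [List.mem_cons, List.not_mem_nil, or_false, forall_eq_or_imp, forall_eq] at hlt
    obtain ⟨hc, ha⟩ := hlt
    have hb : (if c = 1 then 2 else 1) < 7 := by split_ifs <;> norm_num
    generalize (if c = 1 then 2 else 1) = b at hp hb
    split at hp
    · simp at hp
    · have hlt := lt_of_mem_others (w := [a, b, c, 0])
      beta_reduce at hp
      split at hp
      · rename_i hw
        rw [hw] at hlt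
        simp only [List.mem_cons, List.not_mem_nil, or_false, forall_eq_or_imp, forall_eq] at hlt
        obtain ⟨hk, he, hf⟩ := hlt
        rw [List.mem_singleton.1 hp, eval_normalize, eval_append]
        exact add_mem (h.extend_mem (h.exchange_mem ha hb hc hk he) (by norm_num) hf)
          (h.extend_mem (h.exchange_mem ha hb (by norm_num) hk he) hc hf)
      · simp at hp
  · simp at hp

theorem products_mem (h : IsTernaryClosed d C) {p : Poly} (hp : p ∈ products) :
    eval p ∈ pairSpan C := by
  simp only [products, List.mem_append] at hp
  rcases hp with ((((hp | hp) | hp) | hp) | hp) | hp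
  · exact h.cubics_mem hp
  · exact h.quintics_mem hp
  · exact h.quinticsWithDouble_mem hp
  · exact h.sexticsWithTriple_mem hp
  · exact h.septics_mem hp
  · exact h.septicCycles_mem hp

theorem le_finrank (h : IsTernaryClosed d C) [Module.Finite (ZMod 3) C] :
    1014 ≤ Module.finrank (ZMod 3) C := by
  have hkeys := nodup_of_distinctMod _ _ distinctMod_basisKeys
  have hmap : (((List.range 7).map fun n => (2 ^ n, letter n)) ++
      products.map fun p => (raiseKey (lead p).1, d (eval p))).map Prod.fst = basisKeys := by
    rw [List.map_append, List.map_map, List.map_map]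
    rfl
  rw [← length_basisKeys, ← hmap, List.length_map]
  rw [← hmap] at hkeys
  refine length_le_finrank hkeys (fun t ht => ?_) fun t ht => ?_
  · rcases List.mem_append.1 ht with ht | ht
    · obtain ⟨n, -, rfl⟩ := List.mem_map.1 ht
      exact ⟨1, [n], one_ne_zero, by simp, by simp [key], by simp⟩
    · obtain ⟨p, hp, rfl⟩ := List.mem_map.1 ht
      have hlead := List.all_eq_true.1 lead_products p hp
      rw [Bool.and_eq_true] at hlead
      exact (hasLead_eval p hlead.1).map h.leibniz h.map_letter (Nat.blt_eq.mp hlead.2)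
  · rcases List.mem_append.1 ht with ht | ht
    · obtain ⟨n, hn, rfl⟩ := List.mem_map.1 ht
      exact h.letter_mem n (List.mem_range.1 hn)
    · obtain ⟨p, hp, rfl⟩ := List.mem_map.1 ht
      exact h.map_mem (h.products_mem hp)

end IsTernaryClosed

end Word

/-- with `d` the derivation of `Gr` sending `ι(e_{i,j})` to
`ι(e_{i,j+1})` and `T x y z = -d (x*y*z)`, the smallest `𝔽₃`-subspace of `Gr`
containing `g₀, …, g_{6}` and closed under `T` has dimension `1014`. -/
theorem stmt_5 (d : Gr →ₗ[ZMod 3] Gr)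
    (hLeib : ∀ u v : Gr, d (u * v) = d u * v + u * d v)
    (hd : ∀ i j : ℕ, d (gen i j) = gen i (j + 1)) :
    Module.finrank (ZMod 3)
      ↥(sInf {p : Submodule (ZMod 3) Gr |
          (∀ i < 7, g i ∈ p) ∧
          ∀ x y z : Gr, x ∈ p → y ∈ p → z ∈ p → -d (x * y * z) ∈ p}) = 1014 := by
  have hd' : ∀ n, d (Word.letter n) = Word.letter (n + 7) := by
    intro n
    rw [Word.letter, hd, Word.letter, Nat.add_mod_right, Nat.add_div_right _ (by norm_num)]
  have hg : ∀ i < 7, Word.letter i = g i := by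
    intro i hi
    rw [Word.letter, Nat.mod_eq_of_lt hi, Nat.div_eq_of_lt hi]
  obtain ⟨p, hfin, hrank, hp, hT⟩ := Word.exists_finrank_le hLeib hd'
  set C := sInf {p : Submodule (ZMod 3) Gr | (∀ i < 7, g i ∈ p) ∧
    ∀ x y z : Gr, x ∈ p → y ∈ p → z ∈ p → -d (x * y * z) ∈ p} with hC
  have hle : C ≤ p := sInf_le ⟨fun i hi => hg i hi ▸ hp i hi, hT⟩
  have hfinC : Module.Finite (ZMod 3) C := Submodule.finiteDimensional_of_le hle
  have hclosed : Word.IsTernaryClosed d C := by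
    refine ⟨hLeib, hd', fun i hi => ?_, fun x y z hx hy hz => ?_⟩
    · rw [hg i hi, hC, Submodule.mem_sInf]
      exact fun q hq => hq.1 i hi
    · rw [hC, Submodule.mem_sInf] at hx hy hz ⊢
      exact fun q hq => hq.2 x y z (hx q hq) (hy q hq) (hz q hq)
  exact le_antisymm ((Submodule.finrank_mono hle).trans hrank) hclosed.le_finrank
end
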